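/- arXiv:1701.02573 — 5 statements merged into one kernel-verified Lean document; each statement's English description precedes it below -/
import Mathlib

section
/- Let (R, m) be a commutative local ring and W ∈ R. Then there exists a matrix factorization of W over R that is not contractible if and only if W ∈ m². -/
open Matrix

/-- A (proof-free) matrix factorization datum over a commutative ring `R`:
two finite free modules presented by finite index types together with the two
structure matrices `A` (for `φ₁ : F₁ → F₀`) and `B` (for `φ₀ : F₀ → F₁`). -/
structure MF (R : Type) [CommRing R] : Type 1 where
  ι1 : Type
  ι0 : Type
  [fin1 : Fintype ι1]
  [fin0 : Fintype ι0]
  [dec1 : DecidableEq ι1]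
  [dec0 : DecidableEq ι0]
  A : Matrix ι0 ι1 R
  B : Matrix ι1 ι0 R

attribute [instance] MF.fin1 MF.fin0 MF.dec1 MF.dec0

namespace MF

variable {R S : Type} [CommRing R] [CommRing S]

/-- `F` is a matrix factorization of `w`: `φ₀ ∘ φ₁ = w • id` and `φ₁ ∘ φ₀ = w • id`. -/
def IsMF (w : R) (F : MF R) : Prop :=
  F.B * F.A = w • (1 : Matrix F.ι1 F.ι1 R) ∧ F.A * F.B = w • (1 : Matrix F.ι0 F.ι0 R)

/-- A matrix factorization is contractible if the identity is null-homotopic. -/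
def Contractible (F : MF R) : Prop :=
  ∃ (h0 : Matrix F.ι1 F.ι0 R) (h1 : Matrix F.ι0 F.ι1 R),
    (1 : Matrix F.ι0 F.ι0 R) = F.A * h0 + h1 * F.B ∧
    (1 : Matrix F.ι1 F.ι1 R) = F.B * h1 + h0 * F.A

/-- Base change of a matrix factorization along a ring homomorphism. -/
def map (f : R →+* S) (F : MF R) : MF S where
  ι1 := F.ι1
  ι0 := F.ι0
  A := F.A.map f
  B := F.B.map f

/-- The support of a matrix factorization: the primes where its localization is
not contractible. -/
def Supp (F : MF R) : Set (PrimeSpectrum R) :=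
  { p | ¬ Contractible (F.map (algebraMap R (Localization.AtPrime p.asIdeal))) }

end MF

/-- The Koszul-type extension of a matrix factorization of `w` to one of `w + a * b`. -/
def MF.koszulExtend {R : Type} [CommRing R] (F : MF R) (a b : R) : MF R where
  ι1 := F.ι1 ⊕ F.ι0
  ι0 := F.ι0 ⊕ F.ι1
  A := fromBlocks F.A (a • 1) (-(b • 1)) F.B
  B := fromBlocks F.B (-(a • 1)) (b • 1) F.A

theorem MF.IsMF.koszulExtend {R : Type} [CommRing R] {w : R} {F : MF R} (hF : F.IsMF w)
    (a b : R) : (F.koszulExtend a b).IsMF (w + a * b) := by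
  obtain ⟨hBA, hAB⟩ := hF
  constructor
  · change fromBlocks F.B (-(a • 1)) (b • 1) F.A * fromBlocks F.A (a • 1) (-(b • 1)) F.B =
      (w + a * b) • (1 : Matrix (F.ι1 ⊕ F.ι0) (F.ι1 ⊕ F.ι0) R)
    rw [fromBlocks_multiply, ← fromBlocks_one, fromBlocks_smul]
    simp [hBA, hAB, smul_smul, add_smul, mul_comm b a, add_comm]
  · change fromBlocks F.A (a • 1) (-(b • 1)) F.B * fromBlocks F.B (-(a • 1)) (b • 1) F.A =
      (w + a * b) • (1 : Matrix (F.ι0 ⊕ F.ι1) (F.ι0 ⊕ F.ι1) R)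
    rw [fromBlocks_multiply, ← fromBlocks_one, fromBlocks_smul]
    simp [hBA, hAB, smul_smul, add_smul, mul_comm b a, add_comm]

theorem Matrix.mul_apply_mem_left {R m n o : Type*} [CommRing R] [Fintype n] {I : Ideal R}
    {M : Matrix m n R} (hM : ∀ i j, M i j ∈ I) (N : Matrix n o R) (i : m) (j : o) :
    (M * N) i j ∈ I :=
  I.sum_mem fun k _ => I.mul_mem_right _ (hM i k)

theorem Matrix.mul_apply_mem_right {R m n o : Type*} [CommRing R] [Fintype n] {I : Ideal R}
    (M : Matrix m n R) {N : Matrix n o R} (hN : ∀ i j, N i j ∈ I) (i : m) (j : o) :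
    (M * N) i j ∈ I :=
  I.sum_mem fun k _ => I.mul_mem_left _ (hN k j)

/-- All entries of both structure matrices lie in `I`. -/
def MF.EntriesIn {R : Type} [CommRing R] (F : MF R) (I : Ideal R) : Prop :=
  (∀ i j, F.A i j ∈ I) ∧ ∀ i j, F.B i j ∈ I

theorem MF.EntriesIn.koszulExtend {R : Type} [CommRing R] {F : MF R} {I : Ideal R}
    (hF : F.EntriesIn I) {a b : R} (ha : a ∈ I) (hb : b ∈ I) :
    (F.koszulExtend a b).EntriesIn I := by
  have scalar {c : R} (hc : c ∈ I) {n : Type} [DecidableEq n] (i j : n) :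
      c * (1 : Matrix n n R) i j ∈ I := I.mul_mem_right _ hc
  constructor
  · rintro (i | i) (j | j)
    · exact hF.1 i j
    · exact scalar ha i j
    · exact I.neg_mem (scalar hb i j)
    · exact hF.2 i j
  · rintro (i | i) (j | j)
    · exact hF.2 i j
    · exact I.neg_mem (scalar ha i j)
    · exact scalar hb i j
    · exact hF.1 i j

theorem MF.EntriesIn.not_contractible {R : Type} [CommRing R] {F : MF R} {I : Ideal R}
    (hF : F.EntriesIn I) (hI : I ≠ ⊤) [Nonempty F.ι0] : ¬ F.Contractible := by
  rintro ⟨h0, h1, e, -⟩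
  obtain ⟨i⟩ := ‹Nonempty F.ι0›
  refine hI (I.eq_top_iff_one.2 ?_)
  have h := congrFun (congrFun e i) i
  rw [one_apply_eq, Matrix.add_apply] at h
  rw [h]
  exact I.add_mem (mul_apply_mem_left hF.1 _ _ _) (mul_apply_mem_right _ hF.2 _ _)

theorem MF.exists_isMF_entriesIn {R : Type} [CommRing R] {I : Ideal R} {w : R}
    (hw : w ∈ I ^ 2) : ∃ F : MF R, F.IsMF w ∧ F.EntriesIn I ∧ Nonempty F.ι0 := by
  suffices H : ∀ v : R, (∃ F : MF R, F.IsMF v ∧ F.EntriesIn I ∧ Nonempty F.ι0) →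
      ∃ F : MF R, F.IsMF (v + w) ∧ F.EntriesIn I ∧ Nonempty F.ι0 by
    rw [← zero_add w]
    refine H 0 ⟨⟨Empty, Unit, 0, 0⟩, ⟨?_, ?_⟩, ⟨fun _ => nofun, nofun⟩, ⟨()⟩⟩
    · simp
    · simp
  rw [pow_two] at hw
  induction hw using Submodule.mul_induction_on' with
  | mem_mul_mem a ha b hb =>
    rintro v ⟨F, hF, hI, ⟨i⟩⟩
    exact ⟨F.koszulExtend a b, hF.koszulExtend a b, hI.koszulExtend ha hb, ⟨Sum.inl i⟩⟩
  | add x _ y _ hx hy =>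
    intro v hv
    rw [← add_assoc]
    exact hy _ (hx v hv)

/-- An endomorphism of a factorization that is null-homotopic and invertible yields a
contraction. -/
theorem MF.IsMF.contractible_of_isUnit {R : Type} [CommRing R] {w : R} {F : MF R}
    (hF : F.IsMF w) (h0 : Matrix F.ι1 F.ι0 R) (h1 : Matrix F.ι0 F.ι1 R)
    (hu0 : IsUnit (F.A * h0 + h1 * F.B)) (hu1 : IsUnit (F.B * h1 + h0 * F.A)) :
    F.Contractible := by
  obtain ⟨hBA, hAB⟩ := hF
  obtain ⟨u0, hu0⟩ := hu0
  obtain ⟨u1, hu1⟩ := hu1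
  have cA : F.A * u1.val = u0.val * F.A := by
    rw [hu0, hu1, Matrix.mul_add, Matrix.add_mul, ← Matrix.mul_assoc, hAB, Matrix.mul_assoc h1, hBA]
    simp [Matrix.mul_assoc, add_comm]
  have cB : F.B * u0.val = u1.val * F.B := by
    rw [hu0, hu1, Matrix.mul_add, Matrix.add_mul, ← Matrix.mul_assoc, hBA, Matrix.mul_assoc h0, hAB]
    simp [Matrix.mul_assoc, add_comm]
  have cA' : u0⁻¹.val * F.A = F.A * u1⁻¹.val := by
    calc u0⁻¹.val * F.A = u0⁻¹.val * (F.A * u1.val) * u1⁻¹.val := by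
          rw [Matrix.mul_assoc, Matrix.mul_assoc F.A, u1.mul_inv, Matrix.mul_one]
      _ = F.A * u1⁻¹.val := by rw [cA, ← Matrix.mul_assoc, u0.inv_mul, Matrix.one_mul]
  have cB' : u1⁻¹.val * F.B = F.B * u0⁻¹.val := by
    calc u1⁻¹.val * F.B = u1⁻¹.val * (F.B * u0.val) * u0⁻¹.val := by
          rw [Matrix.mul_assoc, Matrix.mul_assoc F.B, u0.mul_inv, Matrix.mul_one]
      _ = F.B * u0⁻¹.val := by rw [cB, ← Matrix.mul_assoc, u1.inv_mul, Matrix.one_mul]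
  refine ⟨h0 * u0⁻¹.val, h1 * u1⁻¹.val, ?_, ?_⟩
  · rw [Matrix.mul_assoc h1, cB', ← Matrix.mul_assoc, ← Matrix.mul_assoc, ← Matrix.add_mul,
      ← hu0, u0.mul_inv]
  · rw [Matrix.mul_assoc h0, cA', ← Matrix.mul_assoc, ← Matrix.mul_assoc, ← Matrix.add_mul,
      ← hu1, u1.mul_inv]

/-- Every matrix over a field has a generalized inverse. -/
theorem Matrix.exists_mul_mul_eq_self {K m n : Type*} [Field K] [Fintype m] [Fintype n]
    [DecidableEq m] [DecidableEq n] (M : Matrix m n K) :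
    ∃ G : Matrix n m K, M * G * M = M := by
  obtain ⟨s, hs⟩ := (toLin' M).rangeRestrict.exists_rightInverse_of_surjective
    (LinearMap.range_rangeRestrict _)
  obtain ⟨g, hg⟩ := s.exists_extend
  refine ⟨LinearMap.toMatrix' g, toLin'.injective ?_⟩
  rw [toLin'_mul, toLin'_mul, toLin'_toMatrix']
  refine LinearMap.ext fun x => ?_
  have hgx := LinearMap.congr_fun hg ((toLin' M).rangeRestrict x)
  have hsx := congrArg Subtype.val (LinearMap.congr_fun hs ((toLin' M).rangeRestrict x))
  change g (toLin' M x) = s _ at hgx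
  change toLin' M (s _) = toLin' M x at hsx
  change toLin' M (g (toLin' M x)) = toLin' M x
  rw [hgx, hsx]

theorem Matrix.map_residue_eq_zero_iff {R m n : Type*} [CommRing R] [IsLocalRing R]
    {M : Matrix m n R} :
    M.map (IsLocalRing.residue R) = 0 ↔ ∀ i j, M i j ∈ IsLocalRing.maximalIdeal R := by
  simp [← Matrix.ext_iff, IsLocalRing.residue_eq_zero_iff]

theorem Matrix.exists_residue_mul_mul_eq {R m n : Type*} [CommRing R] [IsLocalRing R]
    [Fintype m] [Fintype n] [DecidableEq m] [DecidableEq n] (M : Matrix m n R) :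
    ∃ G : Matrix n m R, (M * G * M - M).map (IsLocalRing.residue R) = 0 := by
  obtain ⟨g, hg⟩ := (M.map (IsLocalRing.residue R)).exists_mul_mul_eq_self
  choose lift hlift using IsLocalRing.residue_surjective (R := R)
  have hl : (g.map lift).map (IsLocalRing.residue R) = g := by
    ext i j
    exact hlift _
  refine ⟨g.map lift, ?_⟩
  rw [Matrix.map_sub _ (map_sub _), Matrix.map_mul, Matrix.map_mul, hl, hg, sub_self]

theorem Matrix.isUnit_of_map_residue_eq_one {R n : Type*} [CommRing R] [IsLocalRing R]
    [Fintype n] [DecidableEq n] {M : Matrix n n R}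
    (hM : M.map (IsLocalRing.residue R) = 1) : IsUnit M := by
  rw [isUnit_iff_isUnit_det]
  refine isUnit_of_map_unit (IsLocalRing.residue R) _ ?_
  rw [RingHom.map_det, RingHom.mapMatrix_apply, hM, det_one]
  exact isUnit_one

/-- If `B * A = w` with `w ∉ 𝔪 ^ 2`, and `G`, `H` are generalized inverses of `A`, `B` modulo `𝔪`,
then the projection onto the kernel of `A` lands in the range of `B` modulo `𝔪`. -/
theorem Matrix.map_residue_one_sub_mul_one_sub {R m n : Type*} [CommRing R] [IsLocalRing R]
    [Fintype m] [Fintype n] [DecidableEq m] [DecidableEq n] {w : R}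
    (hw : w ∉ IsLocalRing.maximalIdeal R ^ 2) {A : Matrix m n R} {B : Matrix n m R}
    (hBA : B * A = w • (1 : Matrix n n R)) {G : Matrix n m R} {H : Matrix m n R}
    (hG : (A * G * A - A).map (IsLocalRing.residue R) = 0)
    (hH : (B * H * B - B).map (IsLocalRing.residue R) = 0) :
    ((1 - B * H) * (1 - G * A)).map (IsLocalRing.residue R) = 0 := by
  rw [map_residue_eq_zero_iff] at *
  intro i j
  by_contra hij
  rw [IsLocalRing.mem_maximalIdeal, mem_nonunits_iff, not_not] at hij
  have key : w • ((1 - B * H) * (1 - G * A)) = (B * H * B - B) * (A * G * A - A) := by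
    have e1 : B * H * B - B = -((1 - B * H) * B) := by
      rw [Matrix.sub_mul, Matrix.one_mul, neg_sub]
    have e2 : A * G * A - A = -(A * (1 - G * A)) := by
      rw [Matrix.mul_sub, Matrix.mul_one, neg_sub, Matrix.mul_assoc]
    rw [e1, e2, Matrix.neg_mul, Matrix.mul_neg, neg_neg, Matrix.mul_assoc,
      ← Matrix.mul_assoc B A, hBA, Matrix.smul_mul, Matrix.mul_smul, Matrix.one_mul]
  refine hw ((Ideal.mul_unit_mem_iff_mem _ hij).1 ?_)
  have h := congrFun (congrFun key i) j
  rw [smul_apply, smul_eq_mul] at h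
  rw [h, pow_two]
  exact Ideal.sum_mem _ fun k _ => Ideal.mul_mem_mul (hH i k) (hG k j)

theorem MF.IsMF.contractible_of_notMem_sq {R : Type} [CommRing R] [IsLocalRing R] {w : R}
    {F : MF R} (hF : F.IsMF w) (hw : w ∉ IsLocalRing.maximalIdeal R ^ 2) :
    F.Contractible := by
  by_cases hu : IsUnit w
  · refine hF.contractible_of_isUnit F.B 0 ?_ ?_
    · rw [hF.2, Matrix.zero_mul, add_zero, ← Algebra.algebraMap_eq_smul_one]
      exact hu.map _
    · rw [hF.1, Matrix.mul_zero, zero_add, ← Algebra.algebraMap_eq_smul_one]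
      exact hu.map _
  have hw0 : IsLocalRing.residue R w = 0 := (IsLocalRing.residue_eq_zero_iff w).2 hu
  obtain ⟨G, hG⟩ := F.A.exists_residue_mul_mul_eq
  obtain ⟨H, hH⟩ := F.B.exists_residue_mul_mul_eq
  have k1 := map_residue_one_sub_mul_one_sub hw hF.1 hG hH
  have k0 := map_residue_one_sub_mul_one_sub hw hF.2 hH hG
  have smul_zero' {m n : Type} (M : Matrix m n R) :
      (w • M).map (IsLocalRing.residue R) = 0 := by
    ext i j
    simp [hw0]
  refine hF.contractible_of_isUnit (G - G * H * F.B) (H - H * G * F.A)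
    (isUnit_of_map_residue_eq_one ?_) (isUnit_of_map_residue_eq_one ?_)
  · have e : F.A * (G - G * H * F.B) + (H - H * G * F.A) * F.B =
        1 - (1 - F.A * G) * (1 - H * F.B) - w • (H * G) := by
      have hAB : H * G * F.A * F.B = w • (H * G) := by
        rw [Matrix.mul_assoc _ F.A, hF.2, Matrix.mul_smul, Matrix.mul_one]
      rw [Matrix.sub_mul H, hAB]
      simp only [Matrix.mul_sub, Matrix.sub_mul, Matrix.one_mul, Matrix.mul_one, Matrix.mul_assoc]
      abel
    rw [e, Matrix.map_sub _ (map_sub _), Matrix.map_sub _ (map_sub _), k0, smul_zero']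
    simp
  · have e : F.B * (H - H * G * F.A) + (G - G * H * F.B) * F.A =
        1 - (1 - F.B * H) * (1 - G * F.A) - w • (G * H) := by
      have hBA : G * H * F.B * F.A = w • (G * H) := by
        rw [Matrix.mul_assoc _ F.B, hF.1, Matrix.mul_smul, Matrix.mul_one]
      rw [Matrix.sub_mul G, hBA]
      simp only [Matrix.mul_sub, Matrix.sub_mul, Matrix.one_mul, Matrix.mul_one, Matrix.mul_assoc]
      abel
    rw [e, Matrix.map_sub _ (map_sub _), Matrix.map_sub _ (map_sub _), k1, smul_zero']
    simp

theorem stmt0 (R : Type) [CommRing R] [IsLocalRing R] (W : R) :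
    (∃ F : MF R, F.IsMF W ∧ ¬ F.Contractible) ↔
      W ∈ (IsLocalRing.maximalIdeal R) ^ 2 := by
  constructor
  · rintro ⟨F, hF, hc⟩
    by_contra hW
    exact hc (hF.contractible_of_notMem_sq hW)
  · intro hW
    obtain ⟨F, hF, hI, _⟩ := MF.exists_isMF_entriesIn hW
    exact ⟨F, hF, hI.not_contractible (IsLocalRing.maximalIdeal.isMaximal R).ne_top⟩
end

section
/- Let (R, m) be a Noetherian commutative local ring and W ∈ m a non-zero-divisor. Then there exists a finitely generated R/(W)-module M such that M has infinite projective dimension as an R/(W)-module and finite projective dimension as an R-module, if and only if W ∈ m². -/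
open CategoryTheory

/-- A module `M` over a ring `A` has finite projective dimension iff it admits a
projective resolution which vanishes in all sufficiently large degrees. -/
def HasFinProjDim (A : Type) [Ring A] (M : Type) [AddCommGroup M] [Module A M] : Prop :=
  ∃ (P : ProjectiveResolution (ModuleCat.of A M)) (n : ℕ),
    ∀ m : ℕ, n < m → Limits.IsZero (P.complex.X m)

open Limits

section Resolutions

universe v u

variable {C : Type u} [Category.{v} C] [Abelian C]

lemma ProjectiveResolution.hasProjectiveDimensionLT {X : C} (P : ProjectiveResolution X) (n : ℕ)
    (hP : ∀ m, n < m → IsZero (P.complex.X m)) : HasProjectiveDimensionLT X (n + 1) := by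
  let := HasExt.standard C
  refine HasProjectiveDimensionLT.mk fun i hi Y e ↦ ?_
  obtain ⟨f, hf, rfl⟩ := P.extMk_surjective e (i + 1) rfl
  obtain rfl : f = 0 := (hP i hi).eq_of_src _ _
  simp

/-- The augmentation `P.complex.X 0 ⟶ X` of a projective resolution `P` of `X`. -/
noncomputable def ProjectiveResolution.augmentation {X : C} (P : ProjectiveResolution X) :
    P.complex.X 0 ⟶ X :=
  P.π.f 0

lemma ProjectiveResolution.d_comp_augmentation {X : C} (P : ProjectiveResolution X) :
    P.complex.d 1 0 ≫ augmentation P = 0 :=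
  P.complex_d_comp_π_f_zero

lemma ProjectiveResolution.exact_augmentation {X : C} (P : ProjectiveResolution X) :
    (ShortComplex.mk _ _ (d_comp_augmentation P)).Exact :=
  ShortComplex.exact_of_g_is_cokernel _ P.isColimitCokernelCofork

instance ProjectiveResolution.epi_augmentation {X : C} (P : ProjectiveResolution X) :
    Epi (augmentation P) :=
  epi_of_isColimit_cofork P.isColimitCokernelCofork

open ProjectiveResolution in
/-- Splicing a short exact sequence `S` whose middle term is projective with a projective
resolution of `S.X₁` gives a projective resolution of `S.X₃`. -/
noncomputable def spliceResolution {S : ShortComplex C} (hS : S.ShortExact) [Projective S.X₂]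
    (P : ProjectiveResolution S.X₁) : ProjectiveResolution S.X₃ where
  complex := P.complex.augment (augmentation P ≫ S.f)
    (by rw [← Category.assoc, d_comp_augmentation, zero_comp])
  projective n := by
    cases n
    · exact inferInstanceAs (Projective S.X₂)
    · exact P.projective _
  π := (ChainComplex.toSingle₀Equiv _ _).symm ⟨S.g, 
    show (augmentation P ≫ S.f) ≫ S.g = 0 by rw [Category.assoc, S.zero, comp_zero]⟩
  quasiIso := ⟨fun n => by
    have := hS.mono_f
    have := hS.epi_g
    rcases n with _ | _ | n
    · rw [ChainComplex.quasiIsoAt₀_iff, ShortComplex.quasiIso_iff_of_zeros']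
      · dsimp
        let α : ShortComplex.mk (augmentation P ≫ S.f) S.g (by simp) ⟶ S :=
          { τ₁ := augmentation P, τ₂ := 𝟙 _, τ₃ := 𝟙 _ }
        have hα := (ShortComplex.exact_iff_of_epi_of_isIso_of_mono α).2 hS.exact
        refine (ShortComplex.exact_and_epi_g_iff_of_iso ?_).2 ⟨hα, hS.epi_g⟩
        exact ShortComplex.isoMk (Iso.refl _) (Iso.refl _) (Iso.refl _)
          ((Category.id_comp _).trans (Category.comp_id _).symm)
          ((Category.id_comp _).trans
            ((ChainComplex.toSingle₀Equiv_symm_apply_f_zero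
              (C := P.complex.augment _ _) (X := S.X₃) S.g _).symm.trans
              (Category.comp_id _).symm))
      all_goals rfl
    · rw [quasiIsoAt_iff_exactAt' _ _ (ChainComplex.exactAt_succ_single_obj _ _),
        HomologicalComplex.exactAt_iff' _ 2 1 0 (by simp) (by simp)]
      let α : ShortComplex.mk _ _ (d_comp_augmentation P) ⟶
          ShortComplex.mk (P.complex.d 1 0) (augmentation P ≫ S.f)
            (by rw [← Category.assoc, d_comp_augmentation, zero_comp]) :=
        { τ₁ := 𝟙 _, τ₂ := 𝟙 _, τ₃ := S.f }
      exact (ShortComplex.exact_iff_of_epi_of_isIso_of_mono α).1 (exact_augmentation P)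
    · rw [quasiIsoAt_iff_exactAt' _ _ (ChainComplex.exactAt_succ_single_obj _ _),
        HomologicalComplex.exactAt_iff' _ (n + 3) (n + 2) (n + 1) (by simp) (by simp)]
      exact P.exact_succ n⟩

lemma exists_resolution_X₃ {S : ShortComplex C} (hS : S.ShortExact) [Projective S.X₂]
    (h : ∃ (P : ProjectiveResolution S.X₁) (n : ℕ), ∀ m : ℕ, n < m → IsZero (P.complex.X m)) :
    ∃ (P : ProjectiveResolution S.X₃) (n : ℕ), ∀ m : ℕ, n < m → IsZero (P.complex.X m) := by
  obtain ⟨P, n, hP⟩ := h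
  refine ⟨spliceResolution hS P, n + 1, fun m hm ↦ ?_⟩
  obtain ⟨m, rfl⟩ := Nat.exists_eq_succ_of_ne_zero (Nat.ne_zero_of_lt hm)
  exact hP m (Nat.lt_of_succ_lt_succ hm)

end Resolutions

section Modules

variable {A : Type} [Ring A] {M N P : Type} [AddCommGroup M] [Module A M] [AddCommGroup N]
  [Module A N] [AddCommGroup P] [Module A P]

lemma HasFinProjDim.of_projective [Module.Projective A M] : HasFinProjDim A M :=
  have : Projective (ModuleCat.of A M) := (IsProjective.iff_projective M).1 inferInstance
  ⟨ProjectiveResolution.self _, 0, fun _ hm ↦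
    HomologicalComplex.isZero_single_obj_X _ _ _ _ hm.ne'⟩

lemma HasFinProjDim.exists_hasProjectiveDimensionLT (h : HasFinProjDim A M) :
    ∃ n : ℕ, HasProjectiveDimensionLT (ModuleCat.of A M) (n + 1) :=
  let ⟨P, n, hP⟩ := h
  ⟨n, ProjectiveResolution.hasProjectiveDimensionLT P n hP⟩

/-- The short complex of modules attached to an exact pair of linear maps. -/
abbrev exactShortComplex (f : M →ₗ[A] N) (g : N →ₗ[A] P) (h : Function.Exact f g) :
    ShortComplex (ModuleCat A) :=
  .mk (ModuleCat.ofHom f) (ModuleCat.ofHom g)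
    (by ext x; exact h.apply_apply_eq_zero x)

lemma exactShortComplex_shortExact (f : M →ₗ[A] N) (g : N →ₗ[A] P) (h : Function.Exact f g)
    (hf : Function.Injective f) (hg : Function.Surjective g) :
    (exactShortComplex f g h).ShortExact where
  exact := (ShortComplex.ShortExact.moduleCat_exact_iff_function_exact _).2 h
  mono_f := (ModuleCat.mono_iff_injective _).2 hf
  epi_g := (ModuleCat.epi_iff_surjective _).2 hg

lemma HasFinProjDim.of_exact [Module.Projective A N] (f : M →ₗ[A] N) (g : N →ₗ[A] P)
    (h : Function.Exact f g) (hf : Function.Injective f) (hg : Function.Surjective g)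
    (hM : HasFinProjDim A M) : HasFinProjDim A P :=
  have : Projective (ModuleCat.of A N) := (IsProjective.iff_projective N).1 inferInstance
  exists_resolution_X₃ (exactShortComplex_shortExact f g h hf hg) hM

end Modules

lemma map_mem_sq_of_mem_smul_top {R M : Type*} [CommRing R] [AddCommGroup M] [Module R M]
    {I : Ideal R} (f : M →ₗ[R] R) (hf : ∀ x, f x ∈ I) {x : M}
    (hx : x ∈ I • (⊤ : Submodule R M)) : f x ∈ I ^ 2 := by
  have h : I • (⊤ : Submodule R M) ≤ Submodule.comap f (I ^ 2) := by
    refine Submodule.smul_le.2 fun r hr y _ ↦ ?_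
    rw [Submodule.mem_comap, map_smul, smul_eq_mul, sq]
    exact Ideal.mul_mem_mul hr (hf y)
  exact h hx

section MinimalCover

open IsLocalRing TensorProduct

variable {R : Type*} [CommRing R] [IsLocalRing R] {M : Type*} [AddCommGroup M] [Module R M]

/-- A finite module over a local ring has a finite generating family all of whose relations have
coefficients in the maximal ideal. -/
lemma exists_minimal_generators [Module.Finite R M] :
    ∃ (n : ℕ) (v : Fin n → M), Submodule.span R (Set.range v) = ⊤ ∧
      ∀ c : Fin n → R, ∑ i, c i • v i = 0 → ∀ i, c i ∈ maximalIdeal R := by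
  let b := Module.finBasis (ResidueField R) (ResidueField R ⊗[R] M)
  obtain ⟨v, hv⟩ :=
    (TensorProduct.mk_surjective R M (ResidueField R) residue_surjective).comp_left b
  refine ⟨_, v, span_eq_top_of_tmul_eq_basis v b (congr_fun hv), fun c hc i ↦ ?_⟩
  have h : ∑ i, residue R (c i) • b i = 0 := by
    have := congrArg (TensorProduct.mk R (ResidueField R) M 1) hc
    rw [map_sum, map_zero] at this
    rw [← this]
    refine Finset.sum_congr rfl fun i _ ↦ ?_
    rw [map_smul, ← congr_fun hv i]
    exact algebraMap_smul (ResidueField R) (c i) _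
  exact (residue_eq_zero_iff _).1 (Fintype.linearIndependent_iff.1 b.linearIndependent _ h i)

lemma one_tmul_residueField_eq_zero_iff (x : M) :
    (1 : ResidueField R) ⊗ₜ[R] x = 0 ↔ x ∈ maximalIdeal R • (⊤ : Submodule R M) := by
  have h : TensorProduct.quotTensorEquivQuotSMul M (maximalIdeal R) (1 ⊗ₜ[R] x) =
      Submodule.Quotient.mk x := by
    simp
  have h' : (1 : R ⧸ maximalIdeal R) ⊗ₜ[R] x = 0 ↔ x ∈ maximalIdeal R • (⊤ : Submodule R M) := by
    rw [← Submodule.Quotient.mk_eq_zero, ← h, LinearEquiv.map_eq_zero_iff]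
  exact h'

end MinimalCover

section Hypersurface

open IsLocalRing TensorProduct

variable {R : Type} [CommRing R] {W : R}

lemma quotient_span_smul_eq_zero {M : Type*} [AddCommGroup M] [Module R M]
    [Module (R ⧸ Ideal.span {W}) M] [IsScalarTower R (R ⧸ Ideal.span {W}) M] (x : M) :
    W • x = 0 := by
  rw [← algebraMap_smul (R ⧸ Ideal.span {W}) W x, Ideal.Quotient.algebraMap_eq,
    Ideal.Quotient.eq_zero_iff_mem.2 (Ideal.mem_span_singleton_self W), zero_smul]

/-- A finite `R ⧸ (W)`-module of projective dimension at most one over `R` is projective if `W` does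
not lie in the square of the maximal ideal. -/
lemma projective_of_hasProjectiveDimensionLT_two [IsLocalRing R] [IsNoetherianRing R]
    (hW : W ∉ maximalIdeal R ^ 2)
    {M : Type} [AddCommGroup M] [Module R M] [Module (R ⧸ Ideal.span {W}) M]
    [IsScalarTower R (R ⧸ Ideal.span {W}) M] [Module.Finite R M]
    (hM : HasProjectiveDimensionLT (ModuleCat.of R M) 2) :
    Module.Projective (R ⧸ Ideal.span {W}) M := by
  obtain ⟨n, v, hv, hmin⟩ := exists_minimal_generators (R := R) (M := M)
  let f : (Fin n → R) →ₗ[R] M := Fintype.linearCombination R v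
  have hf : Function.Surjective f := by
    rw [← LinearMap.range_eq_top, Fintype.range_linearCombination, hv]
  have hproj : Module.Projective R f.ker := by
    rw [IsProjective.iff_projective, projective_iff_hasProjectiveDimensionLT_one]
    exact (LinearMap.shortExact_shortComplexKer hf).hasProjectiveDimensionLT_X₁ 1
      (projective_iff_hasProjectiveDimensionLT_one.1
        ((IsProjective.iff_projective (Fin n → R)).1 inferInstance)) hM
  have hfree : Module.Free R f.ker := Module.free_of_flat_of_isLocalRing
  let l : (Fin n → R) →ₗ[R] f.ker := (LinearMap.lsmul R (Fin n → R) W).codRestrict f.ker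
    fun x ↦ by simp [quotient_span_smul_eq_zero]
  have hl : Function.Injective (l.lTensor (ResidueField R)) := by
    rw [injective_iff_map_eq_zero]
    intro x hx
    obtain ⟨x, rfl⟩ := TensorProduct.mk_surjective R _ (ResidueField R) residue_surjective x
    rw [TensorProduct.mk_apply, LinearMap.lTensor_tmul, one_tmul_residueField_eq_zero_iff] at hx
    have hxi (i : Fin n) : x i ∈ maximalIdeal R := by
      by_contra hi
      have hi : IsUnit (x i) := by simpa using hi
      have := map_mem_sq_of_mem_smul_top (LinearMap.proj i ∘ₗ f.ker.subtype)
        (fun y ↦ hmin y.1 y.2 i) hx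
      exact hW ((Ideal.mul_unit_mem_iff_mem _ hi).1 this)
    rw [TensorProduct.mk_apply, one_tmul_residueField_eq_zero_iff, pi_eq_sum_univ' x]
    exact Submodule.sum_mem _ fun i _ ↦ Submodule.smul_mem_smul (hxi i) trivial
  obtain ⟨r, hr⟩ := (split_injective_iff_lTensor_residueField_injective l).2 hl
  have hr (x) : r (l x) = x := LinearMap.congr_fun hr x
  have hker (x : f.ker) : l (r x) = x := by
    have h : l (x - l (r x) : f.ker).1 = W • (x - l (r x)) := rfl
    have h' := hr (x - l (r x) : f.ker).1
    rw [h, map_smul, map_sub, hr, sub_self, smul_zero] at h'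
    exact (sub_eq_zero.1 (Subtype.ext h'.symm)).symm
  let g : (Fin n → R ⧸ Ideal.span {W}) →ₗ[R ⧸ Ideal.span {W}] M :=
    Fintype.linearCombination _ v
  have hfg (x : Fin n → R) : g (fun i ↦ Ideal.Quotient.mk _ (x i)) = f x := by
    simp only [g, f, Fintype.linearCombination_apply]
    exact Finset.sum_congr rfl fun i _ ↦ algebraMap_smul _ _ _
  refine Module.Projective.of_equiv (LinearEquiv.ofBijective g ⟨?_, fun y ↦ ?_⟩)
  · rw [injective_iff_map_eq_zero]
    intro x hx
    obtain ⟨x, rfl⟩ := Ideal.Quotient.mk_surjective.comp_left x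
    have hx : f x = 0 := by rw [← hfg]; exact hx
    have h := congrArg Subtype.val (hker ⟨x, hx⟩)
    ext i
    refine Ideal.Quotient.eq_zero_iff_mem.2 (Ideal.mem_span_singleton'.2 ⟨r ⟨x, hx⟩ i, ?_⟩)
    rw [mul_comm]
    exact congr_fun h i
  · obtain ⟨x, rfl⟩ := hf y
    exact ⟨_, hfg x⟩

lemma exact_lsmul_compLeft_mkQ (W : R) (ι : Type*) :
    Function.Exact (LinearMap.lsmul R (ι → R) W) ((Ideal.span {W}).mkQ.compLeft ι) := by
  intro x
  constructor
  · intro hx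
    choose y hy using fun i ↦ Ideal.mem_span_singleton'.1
      ((Submodule.Quotient.mk_eq_zero _).1 (congr_fun hx i))
    exact ⟨y, funext fun i ↦ (mul_comm _ _).trans (hy i)⟩
  · rintro ⟨y, rfl⟩
    exact funext fun i ↦ (Submodule.Quotient.mk_eq_zero _).2
      (Ideal.mul_mem_right _ _ (Ideal.mem_span_singleton_self W))

lemma lsmul_pi_injective (hW : W ∈ nonZeroDivisors R) (ι : Type*) :
    Function.Injective (LinearMap.lsmul R (ι → R) W) :=
  fun _ _ h ↦ funext fun i ↦ (mul_cancel_left_mem_nonZeroDivisors hW).1 (congr_fun h i)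

lemma hasProjectiveDimensionLT_two_pi_quotient (hW : W ∈ nonZeroDivisors R) (n : ℕ) :
    HasProjectiveDimensionLT (ModuleCat.of R (Fin n → R ⧸ Ideal.span {W})) 2 := by
  have hp := projective_iff_hasProjectiveDimensionLT_one.1
    ((IsProjective.iff_projective (R := R) (Fin n → R)).1 inferInstance)
  exact (exactShortComplex_shortExact _ _ (exact_lsmul_compLeft_mkQ W (Fin n))
    (lsmul_pi_injective hW (Fin n))
    (Submodule.mkQ_surjective _).comp_left).hasProjectiveDimensionLT_X₃ 1 hp
      (hasProjectiveDimensionLT_of_ge _ 1 2 one_le_two)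

theorem hasFinProjDim_of_hasProjectiveDimensionLT [IsLocalRing R] [IsNoetherianRing R]
    (hW : W ∈ nonZeroDivisors R) (hW2 : W ∉ maximalIdeal R ^ 2) (n : ℕ)
    (M : Type) [AddCommGroup M] [Module R M] [Module (R ⧸ Ideal.span {W}) M]
    [IsScalarTower R (R ⧸ Ideal.span {W}) M] [Module.Finite (R ⧸ Ideal.span {W}) M]
    (hM : HasProjectiveDimensionLT (ModuleCat.of R M) (n + 2)) :
    HasFinProjDim (R ⧸ Ideal.span {W}) M := by
  induction n generalizing M with
  | zero =>
    have : Module.Finite R M := Module.Finite.trans (R ⧸ Ideal.span {W}) M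
    have := projective_of_hasProjectiveDimensionLT_two hW2 hM
    exact .of_projective
  | succ n ih =>
    obtain ⟨r, f, hf⟩ := Module.Finite.exists_fin' (R ⧸ Ideal.span {W}) M
    have := hasProjectiveDimensionLT_two_pi_quotient hW r
    refine .of_exact f.ker.subtype f f.exact_subtype_ker_map f.ker.subtype_injective hf
      (ih f.ker ?_)
    exact (exactShortComplex_shortExact (f.ker.subtype.restrictScalars R) (f.restrictScalars R)
      f.exact_subtype_ker_map f.ker.subtype_injective hf).hasProjectiveDimensionLT_X₁ _
      (hasProjectiveDimensionLT_of_ge _ 2 _ (Nat.le_add_left 2 n)) hM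

end Hypersurface

section MatrixFactorization

open IsLocalRing

/-- Every element of the square of an ideal `I` admits a matrix square root with entries in `I`. -/
lemma exists_matrix_mul_self_eq {R : Type*} [CommRing R] {I : Ideal R} {w : R} (hw : w ∈ I ^ 2) :
    ∃ (ι : Type) (_ : Fintype ι) (_ : DecidableEq ι) (_ : Nonempty ι) (D : Matrix ι ι R),
      (∀ i j, D i j ∈ I) ∧ D * D = w • 1 := by
  rw [sq] at hw
  suffices h : ∀ x : R, (∃ (ι : Type) (_ : Fintype ι) (_ : DecidableEq ι) (_ : Nonempty ι)
      (D : Matrix ι ι R), (∀ i j, D i j ∈ I) ∧ D * D = x • 1) →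
      ∃ (ι : Type) (_ : Fintype ι) (_ : DecidableEq ι) (_ : Nonempty ι)
      (D : Matrix ι ι R), (∀ i j, D i j ∈ I) ∧ D * D = (x + w) • 1 by
    simpa using h 0 ⟨Unit, inferInstance, inferInstance, inferInstance, 0, by simp, by simp⟩
  induction hw using Submodule.mul_induction_on' with
  | mem_mul_mem a ha b hb =>
    rintro x ⟨ι, _, _, _, D, hD, hx⟩
    refine ⟨ι ⊕ ι, inferInstance, inferInstance, inferInstance,
      Matrix.fromBlocks D (a • 1) (b • 1) (-D), ?_, ?_⟩
    · have h1 (c : R) (hc : c ∈ I) (i j : ι) : (c • (1 : Matrix ι ι R)) i j ∈ I :=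
        Ideal.mul_mem_right _ _ hc
      rintro (i | i) (j | j)
      exacts [hD i j, h1 a ha i j, h1 b hb i j, I.neg_mem (hD i j)]
    · rw [Matrix.fromBlocks_multiply, ← Matrix.fromBlocks_one, Matrix.fromBlocks_smul]
      simp [hx, smul_smul, add_smul, mul_comm, add_comm]
  | add y _ z _ hy hz =>
    intro x hx
    rw [← add_assoc]
    exact hz _ (hy _ hx)

lemma not_projective_range_of_range_eq_ker {B : Type*} [CommRing B] [IsLocalRing B] {F : Type*}
    [AddCommGroup F] [Module B F] [Module.Finite B F] [Nontrivial F] (d : F →ₗ[B] F)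
    (hker : d.ker = d.range) (hd : d.range ≤ maximalIdeal B • ⊤) :
    ¬ Module.Projective B d.range := by
  intro hproj
  obtain ⟨s, hs⟩ := Module.projective_lifting_property d.rangeRestrict LinearMap.id
    d.surjective_rangeRestrict
  have hs (x : d.range) : d (s x) = x := congrArg Subtype.val (LinearMap.congr_fun hs x)
  have hbot : d.range = ⊥ := by
    refine Submodule.eq_bot_of_le_smul_of_le_jacobson_bot (maximalIdeal B) _
      (LinearMap.range_eq_map d ▸ Module.Finite.fg_top.map d) ?_ (maximalIdeal_le_jacobson _)
    let p : F →ₗ[B] F := LinearMap.id - s ∘ₗ d.rangeRestrict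
    have hp : p.range ≤ d.range := by
      rintro _ ⟨y, rfl⟩
      rw [← hker, LinearMap.mem_ker]
      simp [p, hs]
    intro x hx
    have hpx : p x = x := by
      have : d.rangeRestrict x = 0 := Subtype.ext (LinearMap.mem_ker.1 (hker ▸ hx))
      simp [p, this]
    have h := Submodule.mem_map_of_mem (f := p) (hd hx)
    rw [Submodule.map_smul'', Submodule.map_top, hpx] at h
    exact Submodule.smul_mono le_rfl hp h
  have htop : d.ker = ⊤ := LinearMap.ker_eq_top.2 (LinearMap.range_eq_bot.1 hbot)
  exact bot_ne_top (hbot.symm.trans (hker.symm.trans htop))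

lemma not_hasFinProjDim_range_of_range_eq_ker {B : Type} [CommRing B] [IsLocalRing B] {F : Type}
    [AddCommGroup F] [Module B F] [Module.Finite B F] [Module.Projective B F] [Nontrivial F]
    (d : F →ₗ[B] F) (hker : d.ker = d.range) (hd : d.range ≤ maximalIdeal B • ⊤) :
    ¬ HasFinProjDim B d.range := by
  intro h
  obtain ⟨n, hn⟩ := h.exists_hasProjectiveDimensionLT
  have hF : HasProjectiveDimensionLT (ModuleCat.of B F) 1 :=
    projective_iff_hasProjectiveDimensionLT_one.1
      ((IsProjective.iff_projective F).1 inferInstance)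
  have hS := exactShortComplex_shortExact d.range.subtype d.rangeRestrict
    (LinearMap.exact_iff.2 (by rw [LinearMap.ker_rangeRestrict, Submodule.range_subtype, hker]))
    d.range.subtype_injective d.surjective_rangeRestrict
  refine not_projective_range_of_range_eq_ker d hker hd ?_
  rw [IsProjective.iff_projective, projective_iff_hasProjectiveDimensionLT_one]
  induction n with
  | zero => exact hn
  | succ n ih =>
    exact ih (hS.hasProjectiveDimensionLT_X₁ (n + 1)
      (hasProjectiveDimensionLT_of_ge _ 1 _ (Nat.le_add_left 1 n)) hn)

/-- An endomorphism of `Rⁿ` squaring to a nonzerodivisor `W` of the maximal ideal, with entries in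
the maximal ideal, gives an `R ⧸ (W)`-module of infinite projective dimension which has projective
dimension at most one over `R`. -/
lemma exists_module_of_matrix {R : Type} [CommRing R] [IsLocalRing R] {W : R}
    (hWm : W ∈ maximalIdeal R) (hW : W ∈ nonZeroDivisors R) {ι : Type} [Fintype ι] [DecidableEq ι]
    [Nonempty ι] (D : Matrix ι ι R) (hD : ∀ i j, D i j ∈ maximalIdeal R) (hDD : D * D = W • 1) :
    ∃ N : Submodule (R ⧸ Ideal.span {W}) (ι → R ⧸ Ideal.span {W}),
      Module.Finite (R ⧸ Ideal.span {W}) N ∧ ¬ HasFinProjDim (R ⧸ Ideal.span {W}) N ∧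
        HasFinProjDim R N := by
  have hnontriv : Nontrivial (R ⧸ Ideal.span {W}) :=
    Ideal.Quotient.nontrivial_iff.2 fun h ↦ (maximalIdeal.isMaximal R).ne_top
      (top_le_iff.1 (h ▸ (Ideal.span_singleton_le_iff_mem _).2 hWm))
  have hlocal : IsLocalRing (R ⧸ Ideal.span {W}) :=
    .of_surjective' (Ideal.Quotient.mk _) Ideal.Quotient.mk_surjective
  let q : (ι → R) →ₗ[R] (ι → R ⧸ Ideal.span {W}) := (Ideal.span {W}).mkQ.compLeft ι
  have hq : Function.Surjective q := (Submodule.mkQ_surjective _).comp_left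
  have hq0 (x : ι → R) : q x = 0 ↔ ∃ y, W • y = x := exact_lsmul_compLeft_mkQ W ι x
  let δ : (ι → R) →ₗ[R] (ι → R) := D.mulVecLin
  have hδδ (x) : δ (δ x) = W • x := by
    simp [δ, Matrix.mulVec_mulVec, hDD, Matrix.smul_mulVec]
  have hδ : Function.Injective δ := fun x y h ↦ lsmul_pi_injective hW ι <| by
    rw [LinearMap.lsmul_apply, LinearMap.lsmul_apply, ← hδδ, ← hδδ, h]
  let d : (ι → R ⧸ Ideal.span {W}) →ₗ[R ⧸ Ideal.span {W}] (ι → R ⧸ Ideal.span {W}) :=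
    (D.map (Ideal.Quotient.mk (Ideal.span {W}))).mulVecLin
  have hdq (x : ι → R) : d (q x) = q (δ x) :=
    funext fun i ↦ (RingHom.map_mulVec (Ideal.Quotient.mk (Ideal.span {W})) D x i).symm
  have hdq0 (x : ι → R) : d (q x) = 0 ↔ ∃ y, δ y = x := by
    rw [hdq, hq0]
    constructor
    · rintro ⟨y, hy⟩
      exact ⟨y, hδ (by rw [hδδ, hy])⟩
    · rintro ⟨y, rfl⟩
      exact ⟨y, (hδδ y).symm⟩
  refine ⟨d.range, inferInstance, not_hasFinProjDim_range_of_range_eq_ker d ?_ ?_, ?_⟩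
  · ext x
    obtain ⟨x, rfl⟩ := hq x
    rw [LinearMap.mem_ker, hdq0]
    constructor
    · rintro ⟨y, rfl⟩
      exact ⟨q y, hdq y⟩
    · rintro ⟨y, hy⟩
      rw [← hdq0, ← hy]
      obtain ⟨y, rfl⟩ := hq y
      rw [hdq, hdq, hδδ, hq0]
      exact ⟨y, rfl⟩
  · rintro _ ⟨x, rfl⟩
    rw [pi_eq_sum_univ' (d x)]
    refine Submodule.sum_mem _ fun i _ ↦ Submodule.smul_mem_smul ?_ trivial
    refine Ideal.sum_mem _ fun j _ ↦ Ideal.mul_mem_right _ _ ?_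
    have : IsLocalHom (Ideal.Quotient.mk (Ideal.span {W})) :=
      .of_surjective _ Ideal.Quotient.mk_surjective
    exact map_nonunit (Ideal.Quotient.mk (Ideal.span {W})) _ (hD i j)
  · let g : (ι → R) →ₗ[R] d.range := d.rangeRestrict.restrictScalars R ∘ₗ q
    refine .of_exact δ g (fun x ↦ ?_) hδ (d.surjective_rangeRestrict.comp hq) .of_projective
    exact Subtype.ext_iff.trans (hdq0 x)

end MatrixFactorization

theorem stmt1 (R : Type) [CommRing R] [IsLocalRing R] [IsNoetherianRing R]
    (W : R) (hWm : W ∈ IsLocalRing.maximalIdeal R) (hW : W ∈ nonZeroDivisors R) :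
    (∃ (M : Type) (_ : AddCommGroup M) (_ : Module (R ⧸ Ideal.span {W}) M),
        Module.Finite (R ⧸ Ideal.span {W}) M ∧
        ¬ HasFinProjDim (R ⧸ Ideal.span {W}) M ∧
        (letI : Module R M := Module.compHom M (Ideal.Quotient.mk (Ideal.span {W}));
          HasFinProjDim R M)) ↔
      W ∈ (IsLocalRing.maximalIdeal R) ^ 2 := by
  constructor
  · rintro ⟨M, _, _, _, hM, hMR⟩
    by_contra hW2
    let : Module R M := Module.compHom M (Ideal.Quotient.mk (Ideal.span {W}))
    have : IsScalarTower R (R ⧸ Ideal.span {W}) M := ⟨fun r x m ↦ by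
      rw [Algebra.smul_def, mul_smul]
      rfl⟩
    obtain ⟨n, hn⟩ := HasFinProjDim.exists_hasProjectiveDimensionLT hMR
    exact hM (hasFinProjDim_of_hasProjectiveDimensionLT hW hW2 n M
      (hasProjectiveDimensionLT_of_ge _ (n + 1) _ (by lia)))
  · intro hW2
    obtain ⟨ι, _, _, _, D, hD, hDD⟩ := exists_matrix_mul_self_eq hW2
    obtain ⟨N, hfin, hN, hNR⟩ := exists_module_of_matrix hWm hW D hD hDD
    refine ⟨N, inferInstance, inferInstance, hfin, hN, ?_⟩
    have h : Module.compHom N (Ideal.Quotient.mk (Ideal.span {W})) =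
        (inferInstance : Module R N) := Module.ext' _ _ fun r x ↦ rfl
    rw [h]
    exact hNR
end

section
/- Let (R, m) be a Noetherian commutative local ring and W ∈ m a non-zero-divisor. Then there exists a finitely generated R/(W)-module M with infinite projective dimension over R/(W) and finite projective dimension over R, if and only if there exists a matrix factorization of W over R that is not contractible. -/
open Matrix

open CategoryTheory

open Limits in
/-- Splicing a projective resolution of `S.X₁` onto a projective object `S.X₂`. -/
theorem exists_projectiveResolution_of_shortExact {C : Type*} [Category* C] [Abelian C]
    {S : ShortComplex C} (hS : S.ShortExact) [Projective S.X₂]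
    (P : ProjectiveResolution S.X₁) :
    ∃ Q : ProjectiveResolution S.X₃, ∀ n, Q.complex.X (n + 1) = P.complex.X n := by
  obtain ⟨p, hp, hpexact, hpepi⟩ : ∃ (p : P.complex.X 0 ⟶ S.X₁) (hp : P.complex.d 1 0 ≫ p = 0),
      (ShortComplex.mk _ p hp).Exact ∧ Epi p :=
    ⟨P.π.f 0, P.complex_d_comp_π_f_zero, P.exact₀, inferInstanceAs (Epi (P.π.f 0))⟩
  have w : P.complex.d 1 0 ≫ p ≫ S.f = 0 := by
    rw [← Category.assoc, hp, zero_comp]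
  have hmono := hS.mono_f
  have hepi := hS.epi_g
  let K : ChainComplex C ℕ := ChainComplex.augment P.complex (p ≫ S.f) w
  have hK : ∀ n, Projective (K.X n)
    | 0 => inferInstanceAs (Projective S.X₂)
    | n + 1 => P.projective n
  have hexact : ∀ n, K.ExactAt (n + 1) := by
    intro n
    rw [HomologicalComplex.exactAt_iff' _ (n + 1 + 1) (n + 1) n (by simp) (by simp)]
    match n with
    | 0 =>
      let α : ShortComplex.mk _ p hp ⟶ K.sc' 2 1 0 :=
        { τ₁ := 𝟙 _
          τ₂ := 𝟙 _
          τ₃ := S.f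
          comm₁₂ := (Category.id_comp _).trans (Category.comp_id _).symm
          comm₂₃ := Category.id_comp _ }
      have : Epi α.τ₁ := inferInstanceAs (Epi (𝟙 _))
      have : IsIso α.τ₂ := inferInstanceAs (IsIso (𝟙 _))
      have : Mono α.τ₃ := hmono
      exact (ShortComplex.exact_iff_of_epi_of_isIso_of_mono α).1 hpexact
    | n + 1 => exact P.exact_succ n
  have hg : K.d 1 0 ≫ S.g = 0 := by
    change (p ≫ S.f) ≫ S.g = 0
    rw [Category.assoc, S.zero, comp_zero]
  refine ⟨{ complex := K, projective := hK,
            π := (ChainComplex.toSingle₀Equiv _ _).symm ⟨S.g, hg⟩, quasiIso := ⟨fun n ↦ ?_⟩ },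
    fun n ↦ rfl⟩
  cases n
  · rw [ChainComplex.quasiIsoAt₀_iff, ShortComplex.quasiIso_iff_of_zeros']
    · have hex : (ShortComplex.mk (K.d 1 0) S.g hg).Exact := by
        let α : ShortComplex.mk (K.d 1 0) S.g hg ⟶ S :=
          { τ₁ := p
            τ₂ := 𝟙 _
            τ₃ := 𝟙 _
            comm₁₂ := (Category.comp_id _).symm
            comm₂₃ := (Category.id_comp _).trans (Category.comp_id _).symm }
        have : Epi α.τ₁ := hpepi
        have : IsIso α.τ₂ := inferInstanceAs (IsIso (𝟙 _))
        have : Mono α.τ₃ := inferInstanceAs (Mono (𝟙 _))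
        exact (ShortComplex.exact_iff_of_epi_of_isIso_of_mono α).2 hS.exact
      have hπ : ((ChainComplex.toSingle₀Equiv K S.X₃).symm ⟨S.g, hg⟩).f 0 = S.g :=
        ChainComplex.toSingle₀Equiv_symm_apply_f_zero (C := K) (X := S.X₃) S.g hg
      refine (ShortComplex.exact_and_epi_g_iff_of_iso ?_).2 ⟨hex, hepi⟩
      exact ShortComplex.isoMk (Iso.refl _) (Iso.refl _) (Iso.refl _)
        ((Category.id_comp _).trans (Category.comp_id _).symm)
        ((Category.id_comp _).trans (hπ.symm.trans (Category.comp_id _).symm))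
    all_goals rfl
  · rw [quasiIsoAt_iff_exactAt']
    · apply hexact
    · apply ChainComplex.exactAt_succ_single_obj

/-- Finite projective dimension, in terms of vanishing of `Ext`. -/
theorem hasFinProjDim_iff {A : Type} [Ring A] {M : Type} [AddCommGroup M] [Module A M] :
    HasFinProjDim A M ↔ ∃ n, HasProjectiveDimensionLE (ModuleCat.of A M) n := by
  constructor
  · rintro ⟨P, n, hP⟩
    refine ⟨n, HasProjectiveDimensionLT.mk fun i hi Y e ↦ ?_⟩
    obtain ⟨f, hf, rfl⟩ := P.extMk_surjective e (i + 1) rfl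
    obtain rfl : f = 0 := (hP i hi).eq_of_src _ _
    exact P.extMk_zero _ _
  · rintro ⟨n, hn⟩
    suffices h : ∀ X : ModuleCat.{0} A, HasProjectiveDimensionLE X n →
        ∃ P : ProjectiveResolution X, ∀ m, n < m → Limits.IsZero (P.complex.X m) by
      obtain ⟨P, hP⟩ := h _ hn
      exact ⟨P, n, hP⟩
    clear hn
    induction n with
    | zero =>
      intro X hX
      have : Projective X := (projective_iff_hasProjectiveDimensionLE_zero X).2 hX
      refine ⟨ProjectiveResolution.self X, fun m hm ↦ ?_⟩
      exact HomologicalComplex.isZero_single_obj_X _ _ _ _ hm.ne'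
    | succ n ih =>
      intro X hX
      have hS := X.shortExact_projectiveShortComplex
      have hproj : Projective X.projectiveShortComplex.X₂ := inferInstance
      obtain ⟨P, hP⟩ := ih _ ((hS.hasProjectiveDimensionLT_X₃_iff n hproj).1 hX)
      obtain ⟨Q, hQ⟩ := exists_projectiveResolution_of_shortExact hS P
      refine ⟨Q, fun m hm ↦ ?_⟩
      obtain _ | m := m
      · omega
      · rw [hQ]
        exact hP m (by omega)

section ShortExact

variable {A : Type} [Ring A] {M₁ M₂ M₃ : Type} [AddCommGroup M₁] [AddCommGroup M₂]
  [AddCommGroup M₃] [Module A M₁] [Module A M₂] [Module A M₃]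
  {f : M₁ →ₗ[A] M₂} {g : M₂ →ₗ[A] M₃}

theorem Function.Exact.hasProjectiveDimensionLT_left (h : Function.Exact f g)
    (hf : Function.Injective f) (hg : Function.Surjective g) {n : ℕ}
    (h₂ : HasProjectiveDimensionLT (ModuleCat.of A M₂) n)
    (h₃ : HasProjectiveDimensionLT (ModuleCat.of A M₃) (n + 1)) :
    HasProjectiveDimensionLT (ModuleCat.of A M₁) n :=
  (ModuleCat.shortComplex_shortExact
    (ModuleCat.shortComplexOfCompEqZero f g h.linearMap_comp_eq_zero)
      h hf hg).hasProjectiveDimensionLT_X₁ n h₂ h₃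

theorem Function.Exact.hasProjectiveDimensionLT_right (h : Function.Exact f g)
    (hf : Function.Injective f) (hg : Function.Surjective g) {n : ℕ}
    (h₁ : HasProjectiveDimensionLT (ModuleCat.of A M₁) n)
    (h₂ : HasProjectiveDimensionLT (ModuleCat.of A M₂) (n + 1)) :
    HasProjectiveDimensionLT (ModuleCat.of A M₃) (n + 1) :=
  (ModuleCat.shortComplex_shortExact
    (ModuleCat.shortComplexOfCompEqZero f g h.linearMap_comp_eq_zero)
      h hf hg).hasProjectiveDimensionLT_X₃ n h₁ h₂

theorem hasProjectiveDimensionLE_zero_iff_module_projective :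
    HasProjectiveDimensionLE (ModuleCat.of A M₁) 0 ↔ Module.Projective A M₁ :=
  (projective_iff_hasProjectiveDimensionLE_zero _).symm.trans
    (IsProjective.iff_projective (R := A) (P := M₁)).symm

theorem hasProjectiveDimensionLT_of_module_projective [Module.Projective A M₁] (n : ℕ) :
    HasProjectiveDimensionLT (ModuleCat.of A M₁) (n + 1) :=
  have := hasProjectiveDimensionLE_zero_iff_module_projective.2 ‹Module.Projective A M₁›
  hasProjectiveDimensionLT_of_ge _ 1 _ (by omega)

end ShortExact

/-- A quotient of a projective module is projective iff the quotient map factors through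
an endomorphism of the projective module. -/
theorem Module.projective_iff_exists_comp_eq {A P M : Type*} [Ring A] [AddCommGroup P]
    [AddCommGroup M] [Module A P] [Module A M] [Module.Projective A P] {g : P →ₗ[A] M}
    (hg : Function.Surjective g) :
    Module.Projective A M ↔
      ∃ E : P →ₗ[A] P, LinearMap.ker g ≤ LinearMap.ker E ∧ g ∘ₗ E = g := by
  constructor
  · intro _
    obtain ⟨s, hs⟩ := Module.projective_lifting_property g LinearMap.id hg
    refine ⟨s ∘ₗ g, LinearMap.ker_le_ker_comp g s, ?_⟩
    rw [← LinearMap.comp_assoc, hs, LinearMap.id_comp]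
  · rintro ⟨E, hE, hgE⟩
    refine Module.Projective.of_split
      ((LinearMap.ker g).liftQ E hE ∘ₗ (g.quotKerEquivOfSurjective hg).symm.toLinearMap) g ?_
    ext x
    obtain ⟨y, rfl⟩ := hg x
    have : (g.quotKerEquivOfSurjective hg).symm (g y) = (LinearMap.ker g).mkQ y := by
      rw [LinearEquiv.symm_apply_eq]
      rfl
    simpa [this] using LinearMap.congr_fun hgE y

section MatrixReduction

variable {R S : Type*} [CommRing R] [CommRing S] [Algebra R S] {W : R} {m n : Type*}

theorem Matrix.exists_map_algebraMap_eq (hS : Function.Surjective (algebraMap R S))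
    (X : Matrix m n S) : ∃ Y : Matrix m n R, Y.map (algebraMap R S) = X := by
  choose f hf using fun i j ↦ hS (X i j)
  exact ⟨Matrix.of f, Matrix.ext hf⟩

theorem Matrix.exists_eq_smul_of_map_algebraMap_eq_zero
    (hker : ∀ r, algebraMap R S r = 0 ↔ W ∣ r) {X : Matrix m n R}
    (hX : X.map (algebraMap R S) = 0) : ∃ C : Matrix m n R, X = W • C := by
  choose f hf using fun i j ↦ (hker (X i j)).1 (congrFun (congrFun hX i) j)
  exact ⟨Matrix.of f, Matrix.ext hf⟩

theorem Matrix.smul_left_cancel_of_mem_nonZeroDivisors (hW : W ∈ nonZeroDivisors R)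
    {X Y : Matrix m n R} (h : W • X = W • Y) : X = Y := by
  ext i j
  have hij : W * X i j = W * Y i j := congrFun (congrFun h i) j
  exact (mul_cancel_left_mem_nonZeroDivisors hW).1 hij

theorem Matrix.exists_mul_eq_of_forall_mulVec_mem_range {k : Type*} [Fintype k] [Fintype n]
    [DecidableEq n] {A : Matrix m k R} {X : Matrix m n R}
    (h : ∀ x : n → R, ∃ y, A *ᵥ y = X *ᵥ x) : ∃ H : Matrix k n R, A * H = X := by
  choose y hy using fun j ↦ h (Pi.single j 1)
  refine ⟨(Matrix.of y)ᵀ, Matrix.ext_col fun j ↦ ?_⟩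
  have := hy j
  rw [Matrix.mulVec_single_one] at this
  rw [← this]
  rfl

end MatrixReduction

namespace MF

variable {R S : Type} [CommRing R] [CommRing S] [Algebra R S] {W : R} {F : MF R}

/-- The shift of a matrix factorization datum, up to signs: the two maps are exchanged. -/
abbrev swap (F : MF R) : MF R where
  ι1 := F.ι0
  ι0 := F.ι1
  A := F.B
  B := F.A

theorem IsMF.swap (h : F.IsMF W) : F.swap.IsMF W := ⟨h.2, h.1⟩

theorem Contractible.of_swap (h : F.swap.Contractible) : F.Contractible := by
  obtain ⟨h0, h1, e0, e1⟩ := h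
  exact ⟨h1, h0, e1, e0⟩

/-- Left multiplication by the reduction of `A` along `R → S`. -/
noncomputable def redA (S : Type) [CommRing S] [Algebra R S] (F : MF R) :
    (F.ι1 → S) →ₗ[S] (F.ι0 → S) :=
  (F.A.map (algebraMap R S)).mulVecLin

theorem redA_apply (x : F.ι1 → S) : F.redA S x = F.A.map (algebraMap R S) *ᵥ x := rfl

theorem redA_algebraMap (x : F.ι1 → R) :
    F.redA S (algebraMap R S ∘ x) = algebraMap R S ∘ (F.A *ᵥ x) := by
  rw [redA_apply]
  ext i
  exact (RingHom.map_mulVec (algebraMap R S) F.A x i).symm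

theorem IsMF.injective_mulVec (hF : F.IsMF W) (hW : W ∈ nonZeroDivisors R) :
    Function.Injective (F.A *ᵥ ·) := by
  intro x y h
  have h' : F.B *ᵥ (F.A *ᵥ x) = F.B *ᵥ (F.A *ᵥ y) := congrArg (F.B *ᵥ ·) h
  simp only [Matrix.mulVec_mulVec, hF.1, Matrix.smul_mulVec, Matrix.one_mulVec] at h'
  ext i
  exact (mul_cancel_left_mem_nonZeroDivisors hW).1 (congrFun h' i)

/-- Periodicity: the reductions of `B` and `A` form an exact sequence. -/
theorem IsMF.exact_redA (hF : F.IsMF W) (hW : W ∈ nonZeroDivisors R)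
    (hS : Function.Surjective (algebraMap R S)) (hker : ∀ r, algebraMap R S r = 0 ↔ W ∣ r) :
    Function.Exact (F.swap.redA S) (F.redA S) := by
  intro x
  constructor
  · intro hx
    obtain ⟨x, rfl⟩ := hS.comp_left x
    replace hx : algebraMap R S ∘ (F.A *ᵥ x) = 0 := (redA_algebraMap x).symm.trans hx
    choose y hy using fun i ↦ (hker ((F.A *ᵥ x) i)).1 (congrFun hx i)
    have hxy : x = F.B *ᵥ y := by
      apply hF.injective_mulVec hW
      simp only [Matrix.mulVec_mulVec, hF.2, Matrix.smul_mulVec, Matrix.one_mulVec]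
      exact funext hy
    exact ⟨algebraMap R S ∘ y, by rw [redA_algebraMap, hxy]⟩
  · rintro ⟨y, rfl⟩
    obtain ⟨y, rfl⟩ := hS.comp_left y
    have h : F.A *ᵥ (F.B *ᵥ y) = W • y := by
      rw [Matrix.mulVec_mulVec, hF.2, Matrix.smul_mulVec, Matrix.one_mulVec]
    rw [redA_algebraMap]
    change F.redA S (algebraMap R S ∘ (F.B *ᵥ y)) = 0
    rw [redA_algebraMap, h]
    ext i
    exact (hker _).2 (dvd_mul_right _ _)

/-- A matrix factorization is contractible iff its cokernel is projective over the
hypersurface ring. -/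
theorem IsMF.projective_iff_contractible (hF : F.IsMF W) (hW : W ∈ nonZeroDivisors R)
    (hS : Function.Surjective (algebraMap R S)) (hker : ∀ r, algebraMap R S r = 0 ↔ W ∣ r)
    {M : Type} [AddCommGroup M] [Module S M] {g : (F.ι0 → S) →ₗ[S] M}
    (hg : Function.Surjective g) (hgA : Function.Exact (F.redA S) g) :
    Module.Projective S M ↔ F.Contractible := by
  rw [Module.projective_iff_exists_comp_eq hg]
  constructor
  · rintro ⟨E, hE, hgE⟩
    obtain ⟨T, hT⟩ := Matrix.exists_map_algebraMap_eq hS (LinearMap.toMatrix' E)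
    have hTE (x : F.ι0 → S) : T.map (algebraMap R S) *ᵥ x = E x := by
      rw [hT, LinearMap.toMatrix'_mulVec]
    obtain ⟨C, hC⟩ : ∃ C : Matrix F.ι0 F.ι1 R, T * F.A = W • C := by
      apply Matrix.exists_eq_smul_of_map_algebraMap_eq_zero hker
      rw [Matrix.map_mul]
      apply Matrix.toLin'.injective
      ext1 x
      ext1
      simp only [Matrix.toLin'_mul, LinearMap.comp_apply, Matrix.toLin'_apply, hTE, map_zero,
        LinearMap.zero_apply]
      exact hE (hgA.apply_apply_eq_zero _)
    obtain ⟨H, hH⟩ : ∃ H : Matrix F.ι1 F.ι0 S,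
        F.A.map (algebraMap R S) * H = (T - 1).map (algebraMap R S) := by
      apply Matrix.exists_mul_eq_of_forall_mulVec_mem_range
      intro x
      obtain ⟨y, hy⟩ := (hgA (E x - x)).1 (by
        rw [map_sub, ← LinearMap.comp_apply, hgE, sub_self])
      refine ⟨y, hy.trans ?_⟩
      rw [Matrix.map_sub _ (map_sub _), Matrix.sub_mulVec, hTE,
        Matrix.map_one _ (map_zero _) (map_one _), Matrix.one_mulVec]
    obtain ⟨H, rfl⟩ := Matrix.exists_map_algebraMap_eq hS H
    obtain ⟨D, hD⟩ : ∃ D : Matrix F.ι0 F.ι0 R, (T - 1) - F.A * H = W • D := by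
      apply Matrix.exists_eq_smul_of_map_algebraMap_eq_zero hker
      rw [Matrix.map_sub _ (map_sub _), Matrix.map_mul, hH, sub_self]
    have hTCB : T = C * F.B := by
      apply Matrix.smul_left_cancel_of_mem_nonZeroDivisors hW
      rw [← Matrix.smul_mul, ← hC, Matrix.mul_assoc, hF.2, Matrix.mul_smul, Matrix.mul_one]
    have hAh : (1 : Matrix F.ι0 F.ι0 R) = F.A * (-(H + F.B * D)) + C * F.B := by
      rw [Matrix.mul_neg, Matrix.mul_add, ← Matrix.mul_assoc, hF.2, Matrix.smul_mul,
        Matrix.one_mul, ← hD, ← hTCB]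
      abel
    refine ⟨_, C, hAh, ?_⟩
    apply Matrix.smul_left_cancel_of_mem_nonZeroDivisors hW
    generalize -(H + F.B * D) = h0 at hAh
    have key : F.A * (F.B * C + h0 * F.A) = F.A := by
      rw [Matrix.mul_add, ← Matrix.mul_assoc, ← Matrix.mul_assoc, hF.2, Matrix.smul_mul,
        Matrix.one_mul, eq_sub_of_add_eq hAh.symm, Matrix.sub_mul, Matrix.mul_assoc C, hF.1,
        Matrix.mul_smul, Matrix.mul_one, Matrix.one_mul]
      abel
    rw [← hF.1]
    conv_lhs => rw [← key]
    rw [← Matrix.mul_assoc, hF.1, Matrix.smul_mul, Matrix.one_mul]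
  · rintro ⟨h0, h1, e0, -⟩
    have hT (x : F.ι0 → R) : (h1 * F.B) *ᵥ x = x - F.A *ᵥ (h0 *ᵥ x) := by
      rw [Matrix.mulVec_mulVec, eq_sub_iff_add_eq', ← Matrix.add_mulVec, ← e0, Matrix.one_mulVec]
    have hE (x : F.ι0 → R) : ((h1 * F.B).map (algebraMap R S)).mulVecLin (algebraMap R S ∘ x) =
        algebraMap R S ∘ ((h1 * F.B) *ᵥ x) := by
      ext i
      exact (RingHom.map_mulVec (algebraMap R S) _ x i).symm
    refine ⟨((h1 * F.B).map (algebraMap R S)).mulVecLin, ?_, ?_⟩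
    · intro x hx
      obtain ⟨y, rfl⟩ := (hgA x).1 hx
      obtain ⟨y, rfl⟩ := hS.comp_left y
      rw [LinearMap.mem_ker, redA_algebraMap, hE, Matrix.mulVec_mulVec, Matrix.mul_assoc, hF.1,
        Matrix.mul_smul, Matrix.mul_one, Matrix.smul_mulVec]
      ext i
      exact (hker _).2 (dvd_mul_right _ _)
    · refine LinearMap.ext fun x ↦ ?_
      obtain ⟨x, rfl⟩ := hS.comp_left x
      have hsub : algebraMap R S ∘ (x - F.A *ᵥ (h0 *ᵥ x)) =
          algebraMap R S ∘ x - F.redA S (algebraMap R S ∘ (h0 *ᵥ x)) := by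
        rw [redA_algebraMap]
        ext i
        simp
      rw [LinearMap.comp_apply, hE, hT, hsub, map_sub, hgA.apply_apply_eq_zero, sub_zero]

/-- A matrix factorization whose cokernel has finite projective dimension over the
hypersurface ring is contractible. -/
theorem IsMF.contractible_of_hasFinProjDim (hF : F.IsMF W) (hW : W ∈ nonZeroDivisors R)
    (hS : Function.Surjective (algebraMap R S)) (hker : ∀ r, algebraMap R S r = 0 ↔ W ∣ r)
    (h : HasFinProjDim S ((F.ι0 → S) ⧸ LinearMap.range (F.redA S))) : F.Contractible := by
  obtain ⟨n, hn⟩ := hasFinProjDim_iff.1 h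
  clear h
  induction n generalizing F with
  | zero =>
    exact (hF.projective_iff_contractible hW hS hker (Submodule.mkQ_surjective _)
      (LinearMap.exact_map_mkQ_range _)).1
        (hasProjectiveDimensionLE_zero_iff_module_projective.1 hn)
  | succ n ih =>
    have hex := hF.exact_redA hW hS hker
    let f : ((F.swap.ι0 → S) ⧸ LinearMap.range (F.swap.redA S)) →ₗ[S] (F.ι0 → S) :=
      (LinearMap.range (F.swap.redA S)).liftQ (F.redA S) hex.linearMap_ker_eq.ge
    have hf : Function.Injective f := by
      rw [← LinearMap.ker_eq_bot]
      exact Submodule.ker_liftQ_eq_bot _ _ _ hex.linearMap_ker_eq.le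
    have hfg : Function.Exact f (LinearMap.range (F.redA S)).mkQ := by
      rw [LinearMap.exact_iff, Submodule.ker_mkQ]
      exact (Submodule.range_liftQ _ _ _).symm
    exact (ih hF.swap (hfg.hasProjectiveDimensionLT_left hf (Submodule.mkQ_surjective _)
      (hasProjectiveDimensionLT_of_module_projective n) hn)).of_swap

/-- The cokernel of a matrix factorization has finite projective dimension over `R`. -/
theorem IsMF.hasFinProjDim_of_exact (hF : F.IsMF W) (hW : W ∈ nonZeroDivisors R)
    (hS : Function.Surjective (algebraMap R S)) (hker : ∀ r, algebraMap R S r = 0 ↔ W ∣ r)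
    {M : Type} [AddCommGroup M] [Module S M] [Module R M] [IsScalarTower R S M]
    {g : (F.ι0 → S) →ₗ[S] M} (hg : Function.Surjective g)
    (hgA : Function.Exact (F.redA S) g) : HasFinProjDim R M := by
  let p : (F.ι0 → R) →ₗ[R] M := g.restrictScalars R ∘ₗ (Algebra.linearMap R S).compLeft F.ι0
  have hp (x : F.ι0 → R) : p x = g (algebraMap R S ∘ x) := rfl
  have hexact : Function.Exact F.A.mulVecLin p := by
    intro x
    rw [hp]
    constructor
    · intro hx
      obtain ⟨y, hy⟩ := (hgA _).1 hx
      obtain ⟨y, rfl⟩ := hS.comp_left y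
      rw [redA_algebraMap] at hy
      choose z hz using fun i ↦ (hker ((x - F.A *ᵥ y) i)).1 (by
        simpa [sub_eq_zero] using (congrFun hy i).symm)
      have hz' : x - F.A *ᵥ y = F.A *ᵥ (F.B *ᵥ z) := by
        rw [Matrix.mulVec_mulVec, hF.2, Matrix.smul_mulVec, Matrix.one_mulVec]
        exact funext hz
      refine ⟨y + F.B *ᵥ z, ?_⟩
      rw [Matrix.mulVecLin_apply, Matrix.mulVec_add, ← hz', add_sub_cancel]
    · rintro ⟨y, rfl⟩
      rw [Matrix.mulVecLin_apply, ← redA_algebraMap, hgA.apply_apply_eq_zero]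
  refine hasFinProjDim_iff.2 ⟨1, hexact.hasProjectiveDimensionLT_right
    (hF.injective_mulVec hW) (hg.comp hS.comp_left)
    (hasProjectiveDimensionLT_of_module_projective 0)
    (hasProjectiveDimensionLT_of_module_projective 1)⟩

end MF

section Existence

variable {R S : Type} [CommRing R] [CommRing S] [Algebra R S] {W : R}

/-- Free modules over the hypersurface ring have projective dimension at most one over `R`. -/
theorem hasProjectiveDimensionLE_one_pi_of_algebraMap_eq_zero_iff (hW : W ∈ nonZeroDivisors R)
    (hS : Function.Surjective (algebraMap R S)) (hker : ∀ r, algebraMap R S r = 0 ↔ W ∣ r)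
    (ι : Type) [Finite ι] : HasProjectiveDimensionLE (ModuleCat.of R (ι → S)) 1 := by
  have hexact : Function.Exact (LinearMap.lsmul R (ι → R) W)
      ((Algebra.linearMap R S).compLeft ι) := by
    intro x
    constructor
    · intro hx
      choose y hy using fun i ↦ (hker (x i)).1 (congrFun hx i)
      exact ⟨y, (funext hy).symm⟩
    · rintro ⟨y, rfl⟩
      ext i
      exact (hker _).2 (dvd_mul_right _ _)
  refine hexact.hasProjectiveDimensionLT_right (fun x y h ↦ funext fun i ↦ ?_) hS.comp_left
    (hasProjectiveDimensionLT_of_module_projective 0)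
    (hasProjectiveDimensionLT_of_module_projective 1)
  exact (mul_cancel_left_mem_nonZeroDivisors hW).1 (congrFun h i)

/-- A finite presentation by an injective matrix of a module killed by `W` extends to a matrix
factorization of `W`. -/
theorem exists_isMF_of_exact {k l : Type} [Fintype k] [Fintype l] [DecidableEq k] [DecidableEq l]
    (hker : ∀ r, algebraMap R S r = 0 ↔ W ∣ r) (A : Matrix k l R)
    (hA : Function.Injective A.mulVecLin) {M : Type} [AddCommGroup M] [Module S M]
    {g : (k → S) →ₗ[S] M}
    (hgA : Function.Exact A.mulVecLin (fun x ↦ g (algebraMap R S ∘ x))) :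
    ∃ B : Matrix l k R, B * A = W • 1 ∧ A * B = W • 1 := by
  obtain ⟨B, hB⟩ : ∃ B : Matrix l k R, A * B = W • (1 : Matrix k k R) := by
    apply Matrix.exists_mul_eq_of_forall_mulVec_mem_range
    intro x
    refine (hgA _).1 ?_
    rw [Matrix.smul_mulVec, Matrix.one_mulVec]
    have : algebraMap R S ∘ (W • x) = 0 := funext fun i ↦ (hker _).2 (dvd_mul_right _ _)
    exact (congrArg g this).trans (map_zero g)
  refine ⟨B, ?_, hB⟩
  apply Matrix.toLin'.injective
  refine LinearMap.ext fun x ↦ hA ?_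
  simp only [Matrix.toLin'_apply, Matrix.mulVecLin_apply, Matrix.mulVec_mulVec]
  rw [← Matrix.mul_assoc, hB, Matrix.smul_mul, Matrix.one_mul, Matrix.mul_smul, Matrix.mul_one]

variable [IsLocalRing R] [IsNoetherianRing R]

/-- A non-projective module over the hypersurface ring which has projective dimension at most one
over `R` is the cokernel of a non-contractible matrix factorization. -/
theorem exists_not_contractible_of_hasProjectiveDimensionLE_one (hW : W ∈ nonZeroDivisors R)
    (hS : Function.Surjective (algebraMap R S)) (hker : ∀ r, algebraMap R S r = 0 ↔ W ∣ r)
    {M : Type} [AddCommGroup M] [Module S M] [Module R M] [IsScalarTower R S M]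
    [Module.Finite S M] (hR : HasProjectiveDimensionLE (ModuleCat.of R M) 1)
    (hM : ¬ Module.Projective S M) : ∃ F : MF R, F.IsMF W ∧ ¬ F.Contractible := by
  obtain ⟨k, g, hg⟩ := Module.Finite.exists_fin' S M
  let p : (Fin k → R) →ₗ[R] M := g.restrictScalars R ∘ₗ (Algebra.linearMap R S).compLeft (Fin k)
  have hp : Function.Surjective p := hg.comp hS.comp_left
  have hexact : Function.Exact (LinearMap.ker p).subtype p := p.exact_subtype_ker_map
  have : Module.Projective R (LinearMap.ker p) :=
    hasProjectiveDimensionLE_zero_iff_module_projective.1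
      (hexact.hasProjectiveDimensionLT_left Subtype.val_injective hp
        (hasProjectiveDimensionLT_of_module_projective 0) hR)
  have : Module.Free R (LinearMap.ker p) := Module.free_of_flat_of_isLocalRing
  let b := Module.finBasis R (LinearMap.ker p)
  let A := LinearMap.toMatrix' ((LinearMap.ker p).subtype ∘ₗ b.equivFun.symm.toLinearMap)
  have hAlin : A.mulVecLin = (LinearMap.ker p).subtype ∘ₗ b.equivFun.symm.toLinearMap :=
    Matrix.toLin'_toMatrix' _
  have hA : Function.Injective A.mulVecLin := by
    rw [hAlin]
    exact Subtype.val_injective.comp b.equivFun.symm.injective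
  have hAp : Function.Exact A.mulVecLin p := by
    rw [LinearMap.exact_iff, hAlin, LinearMap.range_comp, LinearEquiv.range, Submodule.map_top,
      Submodule.range_subtype]
  obtain ⟨B, hBA, hAB⟩ := exists_isMF_of_exact (S := S) hker A hA hAp
  let F : MF R := { ι1 := _, ι0 := _, A := A, B := B }
  have hF : F.IsMF W := ⟨hBA, hAB⟩
  refine ⟨F, hF, fun h ↦ hM ?_⟩
  refine (hF.projective_iff_contractible (g := g) hW hS hker hg fun x ↦ ?_).2 h
  obtain ⟨x, rfl⟩ := hS.comp_left x
  constructor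
  · intro hx
    obtain ⟨y, rfl⟩ := (hAp x).1 hx
    exact ⟨algebraMap R S ∘ y, MF.redA_algebraMap (F := F) y⟩
  · rintro ⟨y, hy⟩
    obtain ⟨y, rfl⟩ := hS.comp_left y
    rw [← hy]
    exact (congrArg g (MF.redA_algebraMap (F := F) y)).trans (hAp.apply_apply_eq_zero y)

theorem exists_not_contractible_of_hasFinProjDim (hW : W ∈ nonZeroDivisors R)
    (hS : Function.Surjective (algebraMap R S)) (hker : ∀ r, algebraMap R S r = 0 ↔ W ∣ r)
    {M : Type} [AddCommGroup M] [Module S M] [Module R M] [IsScalarTower R S M]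
    [Module.Finite S M] (hR : HasFinProjDim R M) (hM : ¬ HasFinProjDim S M) :
    ∃ F : MF R, F.IsMF W ∧ ¬ F.Contractible := by
  have : IsNoetherianRing S := isNoetherianRing_of_surjective R S _ hS
  obtain ⟨n, hn⟩ := hasFinProjDim_iff.1 hR
  replace hn : HasProjectiveDimensionLE (ModuleCat.of R M) (n + 1) :=
    hasProjectiveDimensionLT_of_ge _ (n + 1) _ (by omega)
  clear hR
  rw [hasFinProjDim_iff] at hM
  induction n generalizing M with
  | zero =>
    refine exists_not_contractible_of_hasProjectiveDimensionLE_one hW hS hker hn fun h ↦ hM ?_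
    exact ⟨0, hasProjectiveDimensionLE_zero_iff_module_projective.2 h⟩
  | succ n ih =>
    obtain ⟨k, g, hg⟩ := Module.Finite.exists_fin' S M
    have hexact : Function.Exact (LinearMap.ker g).subtype g := g.exact_subtype_ker_map
    have hexactR : Function.Exact ((LinearMap.ker g).subtype.restrictScalars R)
      (g.restrictScalars R) := hexact
    have hpi := hasProjectiveDimensionLE_one_pi_of_algebraMap_eq_zero_iff hW hS hker (Fin k)
    refine ih (M := LinearMap.ker g) ?_ ?_
    · rintro ⟨m, hm⟩
      exact hM ⟨m + 1, hexact.hasProjectiveDimensionLT_right Subtype.val_injective hg hm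
        (hasProjectiveDimensionLT_of_module_projective _)⟩
    · exact hexactR.hasProjectiveDimensionLT_left Subtype.val_injective hg
        (hasProjectiveDimensionLT_of_ge _ 2 _ (by omega)) hn

end Existence

theorem Ideal.isScalarTower_compHom_quotientMk {R : Type*} [CommRing R] (I : Ideal R) (M : Type*)
    [AddCommGroup M] [Module (R ⧸ I) M] :
    letI : Module R M := Module.compHom M (Ideal.Quotient.mk I)
    IsScalarTower R (R ⧸ I) M :=
  letI : Module R M := Module.compHom M (Ideal.Quotient.mk I)
  ⟨fun r s m ↦ mul_smul (Ideal.Quotient.mk I r) s m⟩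

theorem stmt2 (R : Type) [CommRing R] [IsLocalRing R] [IsNoetherianRing R]
    (W : R) (hWm : W ∈ IsLocalRing.maximalIdeal R) (hW : W ∈ nonZeroDivisors R) :
    (∃ (M : Type) (_ : AddCommGroup M) (_ : Module (R ⧸ Ideal.span {W}) M),
        Module.Finite (R ⧸ Ideal.span {W}) M ∧
        ¬ HasFinProjDim (R ⧸ Ideal.span {W}) M ∧
        (letI : Module R M := Module.compHom M (Ideal.Quotient.mk (Ideal.span {W}));
          HasFinProjDim R M)) ↔
      (∃ F : MF R, F.IsMF W ∧ ¬ F.Contractible) := by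
  have hS : Function.Surjective (algebraMap R (R ⧸ Ideal.span {W})) := Ideal.Quotient.mk_surjective
  have hker (r : R) : algebraMap R (R ⧸ Ideal.span {W}) r = 0 ↔ W ∣ r :=
    Ideal.Quotient.eq_zero_iff_mem.trans Ideal.mem_span_singleton
  constructor
  · rintro ⟨M, _, _, hfin, hM, hR⟩
    let _ : Module R M := Module.compHom M (Ideal.Quotient.mk (Ideal.span {W}))
    have := Ideal.isScalarTower_compHom_quotientMk (Ideal.span {W}) M
    exact exists_not_contractible_of_hasFinProjDim hW hS hker hR hM
  · rintro ⟨F, hF, hne⟩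
    refine ⟨(F.ι0 → R ⧸ Ideal.span {W}) ⧸ LinearMap.range (F.redA (R ⧸ Ideal.span {W})),
      inferInstance, inferInstance, inferInstance,
      fun h ↦ hne (hF.contractible_of_hasFinProjDim hW hS hker h), ?_⟩
    let _ : Module R ((F.ι0 → R ⧸ Ideal.span {W}) ⧸
        LinearMap.range (F.redA (R ⧸ Ideal.span {W}))) :=
      Module.compHom _ (Ideal.Quotient.mk (Ideal.span {W}))
    have := Ideal.isScalarTower_compHom_quotientMk (Ideal.span {W})
      ((F.ι0 → R ⧸ Ideal.span {W}) ⧸ LinearMap.range (F.redA (R ⧸ Ideal.span {W})))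
    exact hF.hasFinProjDim_of_exact hW hS hker (Submodule.mkQ_surjective _)
      (LinearMap.exact_map_mkQ_range _)
end

section
/- Let R be a Noetherian commutative ring, W ∈ R a non-zero-divisor, and let q ⊆ p be prime ideals of R with W ∈ q. Assume there is no finitely generated (R/(W))_p-module with infinite projective dimension over (R/(W))_p and finite projective dimension over R_p. Then for every finitely generated R/(W)-module M of finite projective dimension over R, the localization M_q has finite projective dimension over (R/(W))_q. -/
open CategoryTheory

/-- The image in `R/(W)` of the complement of a prime `m` of `R`; localizing `R/(W)`
at this submonoid gives the localization of `R/(W)` at the prime `m/(W)`. -/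
abbrev imageSubmonoid (R : Type) [CommRing R] (W : R) (m : Ideal R) [m.IsPrime] :
    Submonoid (R ⧸ Ideal.span {W}) :=
  Submonoid.map (Ideal.Quotient.mk (Ideal.span {W})) m.primeCompl

/-- The canonical ring homomorphism `R_m → (R/(W))_m` induced by `R → R/(W)`. -/
noncomputable def locQuotMap (R : Type) [CommRing R] (W : R) (m : Ideal R) [m.IsPrime] :
    Localization.AtPrime m →+* Localization (imageSubmonoid R W m) :=
  IsLocalization.map _ (Ideal.Quotient.mk (Ideal.span {W}))
    (Submonoid.le_comap_map m.primeCompl)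

theorem HasFinProjDim.of_linearEquiv {A : Type} [Ring A] {M N : Type} [AddCommGroup M]
    [Module A M] [AddCommGroup N] [Module A N] (e : M ≃ₗ[A] N) (h : HasFinProjDim A M) :
    HasFinProjDim A N := by
  obtain ⟨P, n, hn⟩ := h
  exact ⟨{ complex := P.complex
           π := P.π ≫ (ChainComplex.single₀ (ModuleCat A)).map e.toModuleIso.hom }, n, hn⟩

/-- Flat base change preserves finiteness of the projective dimension. -/
theorem HasFinProjDim.tensorProduct (A B : Type) [CommRing A] [CommRing B] [inst : Algebra A B]
    [Module.Flat A B] (M : Type) [AddCommGroup M] [Module A M] (h : HasFinProjDim A M) :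
    HasFinProjDim B (TensorProduct A B M) := by
  obtain ⟨P, n, hn⟩ := h
  -- `ModuleCat.extendScalars φ` uses the algebra structure `φ.toAlgebra`
  have hinst : inst = (algebraMap A B).toAlgebra := Algebra.algebra_ext _ _ fun _ ↦ rfl
  generalize algebraMap A B = φ at hinst
  subst hinst
  let F := ModuleCat.extendScalars.{0, 0, 0} φ
  have adj : F ⊣ ModuleCat.restrictScalars φ := ModuleCat.extendRestrictScalarsAdj φ
  have : Limits.PreservesFiniteLimits F :=
    ModuleCat.preservesFiniteLimits_extendScalars_of_flat ‹_›
  have : Limits.PreservesFiniteColimits F :=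
    have := adj.leftAdjoint_preservesColimits
    inferInstance
  have : F.Additive := Functor.additive_of_preserves_binary_products F
  have : F.PreservesProjectiveObjects :=
    Functor.preservesProjectiveObjects_of_adjunction_of_preservesEpimorphisms adj
  exact ⟨F.mapProjectiveResolution P, n, fun m hm ↦ F.map_isZero (hn m hm)⟩

theorem HasFinProjDim.of_isBaseChange {A B : Type} [CommRing A] [CommRing B] [Algebra A B]
    [Module.Flat A B] {M N : Type} [AddCommGroup M] [Module A M] [AddCommGroup N] [Module A N]
    [Module B N] [IsScalarTower A B N] {f : M →ₗ[A] N} (hf : IsBaseChange B f)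
    (h : HasFinProjDim A M) : HasFinProjDim B N :=
  (h.tensorProduct A B M).of_linearEquiv hf.equiv

/-- For submonoids `S ≤ T`, finiteness of the projective dimension passes from `S⁻¹M` over `S⁻¹A`
to `T⁻¹M` over `T⁻¹A`. -/
theorem HasFinProjDim.localizedModule_of_le {A : Type} [CommRing A] {S T : Submonoid A}
    (hST : S ≤ T) {M : Type} [AddCommGroup M] [Module A M]
    (h : HasFinProjDim (Localization S) (LocalizedModule S M)) :
    HasFinProjDim (Localization T) (LocalizedModule T M) := by
  let : Algebra (Localization S) (Localization T) :=
    IsLocalization.localizationAlgebraOfSubmonoidLe _ _ S T hST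
  have : IsScalarTower A (Localization S) (Localization T) :=
    IsLocalization.localization_isScalarTower_of_submonoid_le _ _ S T hST
  have : IsLocalization (T.map (algebraMap A (Localization S))) (Localization T) :=
    IsLocalization.isLocalization_of_submonoid_le _ _ S T hST
  have : Module.Flat (Localization S) (Localization T) :=
    IsLocalization.flat _ (T.map (algebraMap A (Localization S)))
  let : Module (Localization S) (LocalizedModule T M) :=
    Module.compHom _ (algebraMap (Localization S) (Localization T))
  have : IsScalarTower (Localization S) (Localization T) (LocalizedModule T M) :=
    IsScalarTower.of_algebraMap_smul fun _ _ ↦ rfl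
  have : IsScalarTower A (Localization S) (LocalizedModule T M) :=
    IsScalarTower.to₁₂₄ A (Localization S) (Localization T) (LocalizedModule T M)
  have hS := LocalizedModule.isBaseChange S M
  refine HasFinProjDim.of_isBaseChange (f := hS.lift (LocalizedModule.mkLinearMap T M))
    (hS.of_comp ?_) h
  rw [hS.lift_comp]
  exact LocalizedModule.isBaseChange T M

theorem stmt4 (R : Type) [CommRing R] [IsNoetherianRing R]
    (W : R) (hW : W ∈ nonZeroDivisors R)
    (q p : Ideal R) [q.IsPrime] [p.IsPrime] (hqp : q ≤ p) (hWq : W ∈ q)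
    (hp : ¬ ∃ (N : Type) (_ : AddCommGroup N)
        (_ : Module (Localization (imageSubmonoid R W p)) N),
        Module.Finite (Localization (imageSubmonoid R W p)) N ∧
        ¬ HasFinProjDim (Localization (imageSubmonoid R W p)) N ∧
        (letI : Module (Localization.AtPrime p) N := Module.compHom N (locQuotMap R W p);
          HasFinProjDim (Localization.AtPrime p) N)) :
    ∀ (M : Type) (_ : AddCommGroup M) (_ : Module (R ⧸ Ideal.span {W}) M),
      Module.Finite (R ⧸ Ideal.span {W}) M →
      (letI : Module R M := Module.compHom M (Ideal.Quotient.mk (Ideal.span {W}));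
        HasFinProjDim R M) →
      HasFinProjDim (Localization (imageSubmonoid R W q))
        (LocalizedModule (imageSubmonoid R W q) M) := by
  intro M _ _ _ hM
  let : Module R M := Module.compHom M (Ideal.Quotient.mk (Ideal.span {W}))
  have : IsScalarTower R (R ⧸ Ideal.span {W}) M := IsScalarTower.of_algebraMap_smul fun _ _ ↦ rfl
  let N := LocalizedModule (imageSubmonoid R W p) M
  let : Module (Localization.AtPrime p) N := Module.compHom N (locQuotMap R W p)
  have : IsScalarTower R (Localization.AtPrime p) N :=
    IsScalarTower.of_algebraMap_smul fun r x ↦ by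
      change locQuotMap R W p (algebraMap R _ r) • x = r • x
      rw [locQuotMap, IsLocalization.map_eq, algebraMap_smul]
      exact algebraMap_smul (R ⧸ Ideal.span {W}) r x
  let f : M →ₗ[R ⧸ Ideal.span {W}] N := LocalizedModule.mkLinearMap _ M
  have : IsLocalizedModule (Algebra.algebraMapSubmonoid (R ⧸ Ideal.span {W}) p.primeCompl) f :=
    localizedModuleIsLocalizedModule (imageSubmonoid R W p)
  have := IsLocalizedModule.restrictScalars p.primeCompl f
  have : Module.Flat R (Localization.AtPrime p) := IsLocalization.flat _ p.primeCompl
  have hN : HasFinProjDim (Localization.AtPrime p) N :=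
    HasFinProjDim.of_isBaseChange
      (IsLocalizedModule.isBaseChange p.primeCompl _ (f.restrictScalars R)) hM
  have hpq : p.primeCompl ≤ q.primeCompl := fun x hx hxq ↦ hx (hqp hxq)
  refine HasFinProjDim.localizedModule_of_le (S := imageSubmonoid R W p)
    (Submonoid.monotone_map hpq) ?_
  by_contra hfin
  refine hp ⟨N, inferInstance, inferInstance, ?_, hfin, hN⟩
  exact Module.Finite.of_isLocalizedModule (imageSubmonoid R W p)
    (LocalizedModule.mkLinearMap (imageSubmonoid R W p) M)
end

section
/- Let R be a Noetherian commutative ring and Z ⊆ Spec R a Zariski-closed subset. Then there exists a matrix factorization K of 0 over R with Supp(K) = Z. -/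
open Matrix

namespace MF

variable {R S : Type} [CommRing R] [CommRing S]

/-- Multiplication by `r` on `F` is null-homotopic. -/
def SMulNullHomotopic (r : R) (F : MF R) : Prop :=
  ∃ (h0 : Matrix F.ι1 F.ι0 R) (h1 : Matrix F.ι0 F.ι1 R),
    r • (1 : Matrix F.ι0 F.ι0 R) = F.A * h0 + h1 * F.B ∧
    r • (1 : Matrix F.ι1 F.ι1 R) = F.B * h1 + h0 * F.A

/-- The mapping cone of multiplication by `f`, i.e. the tensor product of `F` with the Koszul
factorization of `f`. -/
def cone (f : R) (F : MF R) : MF R where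
  ι1 := F.ι1 ⊕ F.ι0
  ι0 := F.ι0 ⊕ F.ι1
  A := fromBlocks F.A (f • 1) 0 (-F.B)
  B := fromBlocks F.B (f • 1) 0 (-F.A)

theorem IsMF.cone {F : MF R} (hF : F.IsMF 0) (f : R) : (F.cone f).IsMF 0 := by
  obtain ⟨hBA, hAB⟩ := hF
  rw [zero_smul] at hBA hAB
  constructor
  · change fromBlocks F.B (f • 1) 0 (-F.A) * fromBlocks F.A (f • 1) 0 (-F.B) =
      (0 : R) • (1 : Matrix (F.ι1 ⊕ F.ι0) (F.ι1 ⊕ F.ι0) R)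
    simp [fromBlocks_multiply, hBA, hAB]
  · change fromBlocks F.A (f • 1) 0 (-F.B) * fromBlocks F.B (f • 1) 0 (-F.A) =
      (0 : R) • (1 : Matrix (F.ι0 ⊕ F.ι1) (F.ι0 ⊕ F.ι1) R)
    simp [fromBlocks_multiply, hBA, hAB]

theorem smulNullHomotopic_cone_self (f : R) (F : MF R) : (F.cone f).SMulNullHomotopic f := by
  refine ⟨(fromBlocks 0 0 1 0 : Matrix (F.ι1 ⊕ F.ι0) (F.ι0 ⊕ F.ι1) R),
    (fromBlocks 0 0 1 0 : Matrix (F.ι0 ⊕ F.ι1) (F.ι1 ⊕ F.ι0) R), ?_, ?_⟩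
  · change f • (1 : Matrix (F.ι0 ⊕ F.ι1) (F.ι0 ⊕ F.ι1) R) =
      fromBlocks F.A (f • 1) 0 (-F.B) * (fromBlocks 0 0 1 0 : Matrix (F.ι1 ⊕ F.ι0) (F.ι0 ⊕ F.ι1) R) +
        (fromBlocks 0 0 1 0 : Matrix (F.ι0 ⊕ F.ι1) (F.ι1 ⊕ F.ι0) R) *
          fromBlocks F.B (f • 1) 0 (-F.A)
    simp [fromBlocks_multiply, fromBlocks_add, ← fromBlocks_one, fromBlocks_smul]
  · change f • (1 : Matrix (F.ι1 ⊕ F.ι0) (F.ι1 ⊕ F.ι0) R) =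
      fromBlocks F.B (f • 1) 0 (-F.A) * (fromBlocks 0 0 1 0 : Matrix (F.ι0 ⊕ F.ι1) (F.ι1 ⊕ F.ι0) R) +
        (fromBlocks 0 0 1 0 : Matrix (F.ι1 ⊕ F.ι0) (F.ι0 ⊕ F.ι1) R) *
          fromBlocks F.A (f • 1) 0 (-F.B)
    simp [fromBlocks_multiply, fromBlocks_add, ← fromBlocks_one, fromBlocks_smul]

theorem SMulNullHomotopic.cone {F : MF R} {g : R} (hg : F.SMulNullHomotopic g) (f : R) :
    (F.cone f).SMulNullHomotopic g := by
  obtain ⟨h0, h1, e0, e1⟩ := hg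
  refine ⟨(fromBlocks h0 0 0 (-h1) : Matrix (F.ι1 ⊕ F.ι0) (F.ι0 ⊕ F.ι1) R),
    (fromBlocks h1 0 0 (-h0) : Matrix (F.ι0 ⊕ F.ι1) (F.ι1 ⊕ F.ι0) R), ?_, ?_⟩
  · change g • (1 : Matrix (F.ι0 ⊕ F.ι1) (F.ι0 ⊕ F.ι1) R) =
      fromBlocks F.A (f • 1) 0 (-F.B) * fromBlocks h0 0 0 (-h1) +
        fromBlocks h1 0 0 (-h0) * fromBlocks F.B (f • 1) 0 (-F.A)
    simp [fromBlocks_multiply, fromBlocks_add, ← fromBlocks_one, fromBlocks_smul, e0, e1]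
  · change g • (1 : Matrix (F.ι1 ⊕ F.ι0) (F.ι1 ⊕ F.ι0) R) =
      fromBlocks F.B (f • 1) 0 (-F.A) * fromBlocks h1 0 0 (-h0) +
        fromBlocks h0 0 0 (-h1) * fromBlocks F.A (f • 1) 0 (-F.B)
    simp [fromBlocks_multiply, fromBlocks_add, ← fromBlocks_one, fromBlocks_smul, e0, e1]

/-- The Koszul matrix factorization of `0` on a finite set `s`, described by its properties. -/
theorem exists_koszul (s : Finset R) :
    ∃ K : MF R, K.IsMF 0 ∧ Nonempty K.ι1 ∧ (∀ f ∈ s, K.SMulNullHomotopic f) ∧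
      (∀ i j, K.A i j ∈ Ideal.span (s : Set R)) ∧
      (∀ i j, K.B i j ∈ Ideal.span (s : Set R)) := by
  classical
  induction s using Finset.induction_on with
  | empty =>
    exact ⟨{ ι1 := Unit, ι0 := Empty, A := 0, B := 0 }, by constructor <;> simp, ⟨()⟩,
      by simp, by simp, by simp⟩
  | insert f s _ ih =>
    obtain ⟨K, hK, ⟨k⟩, hs, hA, hB⟩ := ih
    have hle : Ideal.span (s : Set R) ≤ Ideal.span ((insert f s : Finset R) : Set R) :=
      Ideal.span_mono (by simp)
    have hf : f ∈ Ideal.span ((insert f s : Finset R) : Set R) :=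
      Ideal.subset_span (by simp)
    refine ⟨K.cone f, hK.cone f, ⟨Sum.inl k⟩, ?_, ?_, ?_⟩
    · intro g hg
      rcases Finset.mem_insert.mp hg with rfl | hg
      · exact smulNullHomotopic_cone_self g K
      · exact (hs g hg).cone f
    · rintro (i | i) (j | j)
      · exact hle (hA i j)
      · exact Ideal.mul_mem_right _ _ hf
      · exact Ideal.zero_mem _
      · exact neg_mem (hle (hB i j))
    · rintro (i | i) (j | j)
      · exact hle (hB i j)
      · exact Ideal.mul_mem_right _ _ hf
      · exact Ideal.zero_mem _
      · exact neg_mem (hle (hA i j))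

theorem SMulNullHomotopic.map {F : MF R} {r : R} (h : F.SMulNullHomotopic r) (φ : R →+* S) :
    (F.map φ).SMulNullHomotopic (φ r) := by
  obtain ⟨h0, h1, e0, e1⟩ := h
  refine ⟨h0.map φ, h1.map φ, ?_, ?_⟩
  · change φ r • (1 : Matrix F.ι0 F.ι0 S) =
      F.A.map φ * h0.map φ + h1.map φ * F.B.map φ
    have := congrArg (fun M => M.map φ) e0
    simpa [Matrix.map_add, Matrix.map_mul, Matrix.map_smul'] using this
  · change φ r • (1 : Matrix F.ι1 F.ι1 S) =
      F.B.map φ * h1.map φ + h0.map φ * F.A.map φ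
    have := congrArg (fun M => M.map φ) e1
    simpa [Matrix.map_add, Matrix.map_mul, Matrix.map_smul'] using this

theorem SMulNullHomotopic.contractible {F : MF R} {r : R} (h : F.SMulNullHomotopic r)
    (hr : IsUnit r) : F.Contractible := by
  obtain ⟨h0, h1, e0, e1⟩ := h
  obtain ⟨u, hu⟩ := hr.exists_left_inv
  refine ⟨u • h0, u • h1, ?_, ?_⟩
  · rw [Matrix.mul_smul, Matrix.smul_mul, ← smul_add, ← e0, smul_smul, hu, one_smul]
  · rw [Matrix.mul_smul, Matrix.smul_mul, ← smul_add, ← e1, smul_smul, hu, one_smul]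

theorem not_contractible_of_entries_mem {F : MF R} (k : F.ι1) {I : Ideal R} (hI : I ≠ ⊤)
    (hA : ∀ i j, F.A i j ∈ I) (hB : ∀ i j, F.B i j ∈ I) : ¬ F.Contractible := by
  rintro ⟨h0, h1, -, e⟩
  refine hI ((Ideal.eq_top_iff_one I).mpr ?_)
  rw [← Matrix.one_apply_eq (α := R) k, e, Matrix.add_apply, Matrix.mul_apply, Matrix.mul_apply]
  exact add_mem (sum_mem fun j _ => I.mul_mem_right _ (hB _ _))
    (sum_mem fun j _ => I.mul_mem_left _ (hA _ _))

end MF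

theorem stmt8 (R : Type) [CommRing R] [IsNoetherianRing R]
    (Z : Set (PrimeSpectrum R)) (hZ : IsClosed Z) :
    ∃ K : MF R, K.IsMF 0 ∧ K.Supp = Z := by
  obtain ⟨I, rfl⟩ := (PrimeSpectrum.isClosed_iff_zeroLocus_ideal Z).mp hZ
  obtain ⟨s, rfl⟩ := IsNoetherian.noetherian I
  obtain ⟨K, hK, ⟨k⟩, hs, hA, hB⟩ := MF.exists_koszul s
  refine ⟨K, hK, ?_⟩
  ext p
  rw [PrimeSpectrum.mem_zeroLocus, SetLike.coe_subset_coe]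
  constructor
  · intro hp
    refine Ideal.span_le.mpr fun f hf => ?_
    by_contra hfp
    exact hp (((hs f hf).map _).contractible
      (IsLocalization.map_units (Localization.AtPrime p.asIdeal)
        (⟨f, hfp⟩ : p.asIdeal.primeCompl)))
  · intro hp
    have hmem : ∀ x ∈ Ideal.span (s : Set R), algebraMap R (Localization.AtPrime p.asIdeal) x ∈
        IsLocalRing.maximalIdeal (Localization.AtPrime p.asIdeal) := fun x hx =>
      (IsLocalization.AtPrime.to_map_mem_maximal_iff _ p.asIdeal x).mpr (hp hx)
    exact MF.not_contractible_of_entries_mem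
      (F := K.map (algebraMap R (Localization.AtPrime p.asIdeal))) k
      (IsLocalRing.maximalIdeal.isMaximal _).ne_top
      (fun i j => hmem _ (hA i j)) (fun i j => hmem _ (hB i j))
end
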